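/- arXiv:2211.04174 — 2 statements merged into one kernel-verified Lean document; each statement's English description precedes it below -/
import Mathlib

section
/- Let n ≥ 1 and let X_1, …, X_n be i.i.d. real random variables with E[X_1] = 0, E[X_1^2] = 1, E[X_1^3] = γ and E[X_1^4] < ∞. Suppose the law of X_1 has a compactly supported continuous component whose density is bounded away from 0, i.e., there exist p ∈ (0,1], a nonempty compact interval and a probability measure ν absolutely continuous with respect to Lebesgue measure, supported on that interval with density bounded away from 0 there, such that Law(X_1) ≥ p·ν as measures. Let W = (X_1 + … + X_n)/√n and Z ~ N(0,1). Then there exists a constant C, depending only on the distribution of X_1 and not on n, such that for every measurable h : ℝ → ℝ with ‖h‖_∞ ≤ 1, |E[h(W)] − E[h(Z)] − (γ/(6√n))·E[(Z^3 − 3Z)·h(Z)]| ≤ C/n. -/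
open MeasureTheory ProbabilityTheory
open scoped ENNReal

namespace Edgeworth

/-- Sequences `g 0, g 1, …` of bounded functions on `ℝ`, each being the derivative of the
previous one: smooth functions all of whose derivatives are bounded, with their derivatives. -/
def smoothJets : Submodule ℝ (ℕ → ℝ → ℝ) where
  carrier := {g | (∀ k x, HasDerivAt (g k) (g (k + 1) x) x) ∧ ∀ k, ∃ C, ∀ x, |g k x| ≤ C}
  zero_mem' := ⟨fun _ x => hasDerivAt_const x (0 : ℝ), fun _ => ⟨0, by simp⟩⟩
  add_mem' := by
    rintro f g ⟨hf, hf'⟩ ⟨hg, hg'⟩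
    refine ⟨fun k x => (hf k x).add (hg k x), fun k => ?_⟩
    obtain ⟨A, hA⟩ := hf' k
    obtain ⟨B, hB⟩ := hg' k
    exact ⟨A + B, fun x => (abs_add_le _ _).trans (add_le_add (hA x) (hB x))⟩
  smul_mem' := by
    rintro c g ⟨hg, hg'⟩
    refine ⟨fun k x => (hg k x).const_mul c, fun k => ?_⟩
    obtain ⟨B, hB⟩ := hg' k
    refine ⟨|c| * B, fun x => ?_⟩
    simpa [abs_mul] using mul_le_mul_of_nonneg_left (hB x) (abs_nonneg c)

/-- The space of smooth functions with bounded derivatives of all orders. -/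
def SmoothJet : Type := smoothJets

namespace SmoothJet

noncomputable instance : AddCommGroup SmoothJet := inferInstanceAs (AddCommGroup smoothJets)

noncomputable instance : Module ℝ SmoothJet := inferInstanceAs (Module ℝ smoothJets)

instance : CoeFun SmoothJet (fun _ => ℕ → ℝ → ℝ) :=
  ⟨fun g => Subtype.val (p := (· ∈ smoothJets)) g⟩

@[ext] lemma ext {f g : SmoothJet} (h : ∀ k x, f k x = g k x) : f = g :=
  Subtype.ext (funext fun k => funext fun x => h k x)

lemma add_apply (f g : SmoothJet) (k : ℕ) (x : ℝ) : (f + g) k x = f k x + g k x := rfl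

lemma smul_apply (c : ℝ) (g : SmoothJet) (k : ℕ) (x : ℝ) : (c • g) k x = c * g k x := rfl

lemma sub_apply (f g : SmoothJet) (k : ℕ) (x : ℝ) : (f - g) k x = f k x - g k x := rfl

end SmoothJet

lemma jet_hasDerivAt (g : SmoothJet) (k : ℕ) (x : ℝ) : HasDerivAt (g k) (g (k + 1) x) x :=
  g.2.1 k x

lemma jet_exists_bound (g : SmoothJet) (k : ℕ) : ∃ C, ∀ x, |g k x| ≤ C := g.2.2 k

lemma jet_continuous (g : SmoothJet) (k : ℕ) : Continuous (g k) :=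
  continuous_iff_continuousAt.2 fun x => (jet_hasDerivAt g k x).continuousAt

lemma jet_integrable_shift (g : SmoothJet) (k : ℕ) (x : ℝ) (ρ : Measure ℝ) [IsFiniteMeasure ρ] :
    Integrable (fun y => g k (x + y)) ρ := by
  obtain ⟨C, hC⟩ := jet_exists_bound g k
  exact Integrable.of_bound
    ((jet_continuous g k).comp (continuous_const.add continuous_id)).aestronglyMeasurable C
    (.of_forall fun y => hC _)

/-- Differentiation. -/
noncomputable def derivOp : Module.End ℝ SmoothJet where
  toFun g :=
    ⟨fun k => g (k + 1), fun k x => jet_hasDerivAt g (k + 1) x, fun k => jet_exists_bound g (k + 1)⟩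
  map_add' _ _ := rfl
  map_smul' _ _ := rfl

/-- The operator `g ↦ ∫ g (· + y) ∂ρ(y)`. -/
noncomputable def convOp (ρ : Measure ℝ) [IsFiniteMeasure ρ] : Module.End ℝ SmoothJet where
  toFun g := ⟨fun k x => ∫ y, g k (x + y) ∂ρ, by
    refine ⟨fun k x => ?_, fun k => ?_⟩
    · obtain ⟨C, hC⟩ := jet_exists_bound g (k + 1)
      refine (hasDerivAt_integral_of_dominated_loc_of_deriv_le (bound := fun _ => C)
        (s := Set.univ) (F := fun x y => g k (x + y)) (F' := fun x y => g (k + 1) (x + y))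
        Filter.univ_mem ?_ ?_ ?_ ?_ ?_ ?_).2
      · exact .of_forall fun x => (jet_integrable_shift g k x ρ).aestronglyMeasurable
      · exact jet_integrable_shift g k x ρ
      · exact (jet_integrable_shift g (k + 1) x ρ).aestronglyMeasurable
      · exact .of_forall fun y z _ => hC _
      · exact integrable_const C
      · exact .of_forall fun y z _ => (jet_hasDerivAt g k (z + y)).comp_add_const z y
    · obtain ⟨C, hC⟩ := jet_exists_bound g k
      refine ⟨C * ρ.real Set.univ, fun x => ?_⟩
      exact norm_integral_le_of_norm_le_const (f := fun y => g k (x + y))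
        (.of_forall fun y => hC _)⟩
  map_add' f g := by
    ext k x
    exact integral_add (jet_integrable_shift f k x ρ) (jet_integrable_shift g k x ρ)
  map_smul' c g := by
    ext k x
    exact integral_const_mul c _

lemma convOp_apply (ρ : Measure ℝ) [IsFiniteMeasure ρ] (g : SmoothJet) (k : ℕ) (x : ℝ) :
    (convOp ρ g) k x = ∫ y, g k (x + y) ∂ρ := rfl

lemma derivOp_apply (g : SmoothJet) (k : ℕ) (x : ℝ) :
    (derivOp g) k x = g (k + 1) x := rfl

lemma convOp_conv (ρ σ : Measure ℝ) [IsFiniteMeasure ρ] [IsFiniteMeasure σ] :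
    convOp (ρ ∗ σ) = convOp ρ * convOp σ := by
  ext g k x
  have h := (jet_integrable_shift g k x (ρ ∗ σ))
  rw [Module.End.mul_apply, convOp_apply, convOp_apply, integral_conv h]
  refine integral_congr_ae (.of_forall fun y => ?_)
  simp only [convOp_apply, add_assoc]

lemma convOp_comm (ρ σ : Measure ℝ) [IsFiniteMeasure ρ] [IsFiniteMeasure σ] :
    convOp ρ * convOp σ = convOp σ * convOp ρ := by
  rw [← convOp_conv, ← convOp_conv]
  congr 1
  exact Measure.conv_comm ρ σ

lemma convOp_add (ρ σ : Measure ℝ) [IsFiniteMeasure ρ] [IsFiniteMeasure σ] :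
    convOp (ρ + σ) = convOp ρ + convOp σ := by
  ext g k x
  exact integral_add_measure (jet_integrable_shift g k x ρ) (jet_integrable_shift g k x σ)

/-- Differentiation and the convolutions with finite measures. -/
noncomputable def opGenerators : Set (Module.End ℝ SmoothJet) :=
  insert derivOp {A | ∃ (ρ : Measure ℝ) (_ : IsFiniteMeasure ρ), A = convOp ρ}

lemma opGenerators_comm : ∀ a ∈ opGenerators, ∀ b ∈ opGenerators, a * b = b * a := by
  rintro a (rfl | ⟨ρ, _, rfl⟩) b (rfl | ⟨σ, _, rfl⟩)
  · rfl
  · rfl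
  · rfl
  · exact convOp_comm ρ σ

/-- The algebra of operators generated by differentiation and by convolutions with finite
measures. -/
noncomputable abbrev OpRing : Subalgebra ℝ (Module.End ℝ SmoothJet) := Algebra.adjoin ℝ opGenerators

noncomputable instance : CommRing OpRing :=
  { (inferInstance : Ring OpRing) with
    mul_comm := (Algebra.isMulCommutative_adjoin ℝ opGenerators_comm).is_comm.comm }

/-- The action of `OpRing` on smooth jets. -/
noncomputable def act : OpRing →ₐ[ℝ] Module.End ℝ SmoothJet := (Algebra.adjoin ℝ opGenerators).val

/-- Differentiation as an element of `OpRing`. -/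
noncomputable def opD : OpRing := ⟨derivOp, Algebra.subset_adjoin (Or.inl rfl)⟩

/-- Convolution with `ρ` as an element of `OpRing`. -/
noncomputable def opT (ρ : Measure ℝ) [h : IsFiniteMeasure ρ] : OpRing :=
  ⟨convOp ρ, Algebra.subset_adjoin (Or.inr ⟨ρ, h, rfl⟩)⟩

lemma act_opD : act opD = derivOp := rfl

lemma act_opT (ρ : Measure ℝ) [IsFiniteMeasure ρ] : act (opT ρ) = convOp ρ := rfl

lemma act_injective : Function.Injective act := Subtype.val_injective

/-- `Dom A B c`: the sup norm of `A g` is at most `c` times that of `B g`. -/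
def Dom (A B : OpRing) (c : ℝ) : Prop :=
  ∀ (g : SmoothJet) (M : ℝ), (∀ x, |(act B g) 0 x| ≤ M) → ∀ x, |(act A g) 0 x| ≤ c * M

/-- `Bd A c`: the operator norm of `A` with respect to the sup norm is at most `c`. -/
abbrev Bd (A : OpRing) (c : ℝ) : Prop := Dom A 1 c

section Dom

variable {A B E : OpRing} {a b c c' : ℝ}

lemma Dom.refl (A : OpRing) : Dom A A 1 := fun g M h x => by simpa using h x

lemma Dom.trans (h : Dom A B c) (h' : Dom B E c') : Dom A E (c * c') := fun g M hM x => by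
  simpa [mul_assoc] using h g (c' * M) (h' g M hM) x

lemma Dom.mul_right (h : Dom A B c) (X : OpRing) : Dom (A * X) (B * X) c := fun g M hM x => by
  simp only [map_mul, Module.End.mul_apply] at hM ⊢
  exact h _ M hM x

lemma Dom.add (h : Dom A E c) (h' : Dom B E c') : Dom (A + B) E (c + c') := fun g M hM x => by
  rw [map_add, LinearMap.add_apply, SmoothJet.add_apply, add_mul]
  exact (abs_add_le _ _).trans (add_le_add (h g M hM x) (h' g M hM x))

lemma Dom.smul (h : Dom A E c) (a : ℝ) : Dom (a • A) E (|a| * c) := fun g M hM x => by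
  rw [map_smul, LinearMap.smul_apply, SmoothJet.smul_apply, abs_mul, mul_assoc]
  exact mul_le_mul_of_nonneg_left (h g M hM x) (abs_nonneg a)

lemma Dom.sub (h : Dom A E c) (h' : Dom B E c') : Dom (A - B) E (c + c') := by
  simpa [sub_eq_add_neg] using h.add (h'.smul (-1))

lemma Dom.mono (h : Dom A E c) (hc : c ≤ c') : Dom A E c' := fun g M hM x =>
  (h g M hM x).trans (mul_le_mul_of_nonneg_right hc ((abs_nonneg _).trans (hM 0)))

lemma Dom.sum {ι : Type*} (s : Finset ι) {A : ι → OpRing} {c : ι → ℝ}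
    (h : ∀ i ∈ s, Dom (A i) E (c i)) : Dom (∑ i ∈ s, A i) E (∑ i ∈ s, c i) := by
  classical
  induction s using Finset.induction_on with
  | empty => intro g M hM x; simp [show ((0 : SmoothJet) : ℕ → ℝ → ℝ) 0 x = 0 from rfl]
  | insert i s hi ih =>
    rw [Finset.sum_insert hi, Finset.sum_insert hi]
    exact (h i (by simp)).add (ih fun j hj => h j (by simp [hj]))

lemma Bd.mul (h : Bd A a) (h' : Bd B b) : Bd (A * B) (a * b) := by
  have := h.mul_right B
  rw [one_mul] at this
  exact this.trans h'

lemma Bd.pow (h : Bd A a) (k : ℕ) : Bd (A ^ k) (a ^ k) := by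
  induction k with
  | zero => simpa using Dom.refl 1
  | succ k ih => rw [pow_succ, pow_succ]; exact Bd.mul ih h

lemma Bd.pow_one (h : Bd A 1) (k : ℕ) : Bd (A ^ k) 1 := by
  simpa using Bd.pow h k

lemma bd_opT (ρ : Measure ℝ) [IsFiniteMeasure ρ] : Bd (opT ρ) (ρ.real Set.univ) := by
  intro g M hM x
  rw [act_opT, convOp_apply, mul_comm]
  exact norm_integral_le_of_norm_le_const (f := fun y => g 0 (x + y))
    (.of_forall fun y => by simpa using hM (x + y))

lemma bd_opT_prob (ρ : Measure ℝ) [IsProbabilityMeasure ρ] : Bd (opT ρ) 1 := by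
  simpa using bd_opT ρ

end Dom

section Binomial

lemma sum_choose_mul_sq (n : ℕ) :
    ∑ i ∈ Finset.range (n + 1), (n.choose i : ℝ) * (2 * (i : ℝ) - n) ^ 2 = 2 ^ n * (n : ℝ) := by
  have h := congrArg (Polynomial.eval (1 / 2 : ℝ)) (bernsteinPolynomial.variance ℝ n)
  simp only [Polynomial.eval_finsetSum, bernsteinPolynomial, Polynomial.eval_mul,
    Polynomial.eval_pow, Polynomial.eval_sub, Polynomial.eval_X,
    Polynomial.eval_natCast, Polynomial.eval_one, nsmul_eq_mul] at h
  have h2 : (2 : ℝ) ^ n * 4 * ((n : ℝ) * (1 / 2) * (1 - 1 / 2)) = 2 ^ n * n := by ring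
  rw [← h2, ← h, Finset.mul_sum]
  refine Finset.sum_congr rfl fun i hi => ?_
  have hi' : i ≤ n := Nat.lt_succ_iff.1 (Finset.mem_range.1 hi)
  have : (1 / 2 : ℝ) ^ i * (1 - 1 / 2) ^ (n - i) * 2 ^ n = 1 := by
    rw [show (1 - 1 / 2 : ℝ) = 1 / 2 by norm_num, ← pow_add, Nat.add_sub_cancel' hi', ← mul_pow]
    norm_num
  linear_combination (-(n.choose i : ℝ) * (2 * i - n) ^ 2) * this

lemma sum_choose_mul_abs_le (n : ℕ) :
    ∑ i ∈ Finset.range (n + 1), (n.choose i : ℝ) * |2 * (i : ℝ) - n| ≤ 2 ^ n * √n := by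
  refine abs_le_of_sq_le_sq' ?_ (by positivity) |>.2
  have h := Finset.sum_mul_sq_le_sq_mul_sq (Finset.range (n + 1))
    (fun i => √(n.choose i : ℝ)) (fun i => √(n.choose i : ℝ) * |2 * (i : ℝ) - n|)
  have e1 : ∀ i : ℕ, √(n.choose i : ℝ) * (√(n.choose i : ℝ) * |2 * (i : ℝ) - n|)
      = (n.choose i : ℝ) * |2 * (i : ℝ) - n| := fun i => by
    rw [← mul_assoc, Real.mul_self_sqrt (by positivity)]
  have e2 : ∀ i : ℕ, (√(n.choose i : ℝ) * |2 * (i : ℝ) - n|) ^ 2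
      = (n.choose i : ℝ) * (2 * i - n) ^ 2 := fun i => by
    rw [mul_pow, Real.sq_sqrt (by positivity), sq_abs]
  have e3 : ∀ i : ℕ, √(n.choose i : ℝ) ^ 2 = (n.choose i : ℝ) := fun i =>
    Real.sq_sqrt (by positivity)
  simp only [e1, e2, e3, sum_choose_mul_sq] at h
  have e4 : ∑ i ∈ Finset.range (n + 1), (n.choose i : ℝ) = 2 ^ n := by
    exact_mod_cast Nat.sum_range_choose n
  rw [e4] at h
  rw [mul_pow, Real.sq_sqrt (by positivity)]
  linarith

lemma sub_one_mul_add_one_pow {R : Type*} [CommRing R] (S : R) (r : ℕ) :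
    (r + 1 : R) * ((S - 1) * (S + 1) ^ r) =
      ∑ i ∈ Finset.range (r + 2), ((r + 1).choose i : R) * (2 * i - (r + 1)) * S ^ i := by
  have h : ∑ i ∈ Finset.range (r + 2), ((r + 1).choose i : R) * i * S ^ i
      = (r + 1) * S * (S + 1) ^ r := by
    rw [Finset.sum_range_succ', add_pow]
    simp only [one_pow, mul_one, Nat.cast_zero, mul_zero, zero_mul, add_zero, Finset.mul_sum]
    refine Finset.sum_congr rfl fun i _ => ?_
    have := congrArg (Nat.cast (R := R)) (Nat.add_one_mul_choose_eq r i)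
    push_cast at this ⊢
    rw [← this]; ring
  have h' := add_pow S 1 (r + 1)
  simp only [one_pow, mul_one] at h'
  have : ∀ i ∈ Finset.range (r + 2), ((r + 1).choose i : R) * (2 * i - (r + 1)) * S ^ i
      = 2 * (((r + 1).choose i : R) * i * S ^ i) - (r + 1) * (S ^ i * (r + 1).choose i) :=
    fun i _ => by ring
  rw [Finset.sum_congr rfl this, Finset.sum_sub_distrib, ← Finset.mul_sum, ← Finset.mul_sum, h,
    ← h']
  ring

lemma bd_sub_one_mul_add_one_pow {S : OpRing} (hS : Bd S 1) (r : ℕ) :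
    Bd ((S - 1) * (S + 1) ^ r) (2 ^ (r + 1) / √(r + 1)) := by
  have hr : (0 : ℝ) < r + 1 := by positivity
  have e : (S - 1) * (S + 1) ^ r = (1 / (r + 1 : ℝ)) •
      ∑ i ∈ Finset.range (r + 2), (((r + 1).choose i : ℝ) * (2 * i - (r + 1))) • S ^ i := by
    rw [eq_comm, one_div, inv_smul_eq_iff₀ hr.ne', Algebra.smul_def]
    simp only [Algebra.smul_def, map_mul, map_add, map_sub, map_natCast, map_one, map_ofNat]
    exact (sub_one_mul_add_one_pow S r).symm
  rw [e]
  refine Dom.mono (Dom.smul (Dom.sum _ fun i _ => (Bd.pow_one hS i).smul _) _) ?_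
  have h := sum_choose_mul_abs_le (r + 1)
  push_cast at h
  simp only [mul_one, abs_mul, Nat.abs_cast]
  rw [abs_of_pos (by positivity), one_div, inv_mul_le_iff₀ hr]
  refine h.trans (le_of_eq ?_)
  rw [mul_div_assoc', mul_comm, eq_div_iff (by positivity), mul_right_comm,
    Real.mul_self_sqrt hr.le]

end Binomial

section Smoothing

variable {D V S S₀ : OpRing} {δ : ℝ} {n : ℕ}

lemma bd_deriv_mul_pow (hδ : 0 < δ) (hV : Bd V 1) (hS : Bd S 1) (hS₀ : Bd S₀ 1)
    (hDV : D * V = (√n / δ) • ((S - 1) * S₀)) (r : ℕ) :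
    Bd (D * (V * ((1 / 2 : ℝ) • (S + 1))) ^ (r + 1)) (2 * √n / (δ * √(r + 2))) := by
  have e : D * (V * ((1 / 2 : ℝ) • (S + 1))) ^ (r + 1) =
      (√n / δ * (1 / 2) ^ (r + 1)) • (V ^ r * S₀ * ((S - 1) * (S + 1) ^ (r + 1))) := by
    have : D * (V * ((1 / 2 : ℝ) • (S + 1))) ^ (r + 1) =
      (D * V) * V ^ r * ((1 / 2 : ℝ) • (S + 1)) ^ (r + 1) := by ring
    rw [this, hDV, smul_pow, mul_smul_comm, smul_mul_assoc, smul_mul_assoc, smul_smul, mul_comm]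
    congr 1
    ring
  rw [e]
  refine Dom.mono (((Bd.mul (Bd.mul (Bd.pow_one hV r) hS₀)
    (bd_sub_one_mul_add_one_pow hS (r + 1)))).smul _) (le_of_eq ?_)
  rw [abs_of_nonneg (by positivity)]
  push_cast
  have h2 : (2 : ℝ) ^ (r + 1 + 1) = 2 * 2 ^ (r + 1) := by ring
  have h1 : (r : ℝ) + 1 + 1 = r + 2 := by ring
  rw [h2, h1, one_div, inv_pow]
  have : √((r : ℝ) + 2) ≠ 0 := by positivity
  field_simp

lemma bd_deriv_pow_mul_pow (hδ : 0 < δ) (hV : Bd V 1) (hS : Bd S 1) (hS₀ : Bd S₀ 1)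
    (hDV : D * V = (√n / δ) • ((S - 1) * S₀)) {k i : ℕ} (hk : 8 ≤ k) (hkn : k + 1 ≤ n)
    (hi : i ≤ 8) :
    Bd (D ^ i * (V * ((1 / 2 : ℝ) • (S + 1))) ^ k) ((1 + 6 / δ) ^ 8 * (n ^ 4 / (k + 1) ^ 4)) := by
  set U := V * ((1 / 2 : ℝ) • (S + 1)) with hU
  have hU1 : Bd U 1 := by
    refine Dom.mono (Bd.mul hV ((hS.add (Dom.refl 1)).smul _)) ?_
    norm_num
  obtain ⟨r, t, rfl, ht⟩ : ∃ r t, k = 8 * (r + 1) + t ∧ t < 8 :=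
    ⟨k / 8 - 1, k % 8, by omega, by omega⟩
  set b : ℝ := (1 + 6 / δ) * (√n / √((8 * (r + 1) + t : ℕ) + 1)) with hb
  have hkn' : (((8 * (r + 1) + t : ℕ) : ℝ) + 1) ≤ n := by exact_mod_cast hkn
  have hpos : (0 : ℝ) < ((8 * (r + 1) + t : ℕ) : ℝ) + 1 := by positivity
  have hq1 : 1 ≤ √n / √((8 * (r + 1) + t : ℕ) + 1) := by
    rw [one_le_div (by positivity)]
    exact Real.sqrt_le_sqrt hkn'
  have hb1 : 1 ≤ b := by
    have : 0 < 6 / δ := by positivity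
    nlinarith
  have hr : Bd (D * U ^ (r + 1)) b := by
    refine (bd_deriv_mul_pow hδ hV hS hS₀ hDV r).mono ?_
    have h8 : √((8 * (r + 1) + t : ℕ) + 1) ≤ 3 * √(r + 2) := by
      rw [Real.sqrt_le_left (by positivity), mul_pow, Real.sq_sqrt (by positivity)]
      have : (t : ℝ) ≤ 7 := by exact_mod_cast Nat.lt_succ_iff.1 ht
      push_cast
      have : (0 : ℝ) ≤ r := by positivity
      linarith
    have h1 : 2 * √n / (δ * √(r + 2)) ≤ 6 / δ * (√n / √((8 * (r + 1) + t : ℕ) + 1)) := by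
      rw [div_mul_div_comm, div_le_div_iff₀ (by positivity) (by positivity)]
      have := mul_le_mul_of_nonneg_left h8 (show 0 ≤ 2 * √(n : ℝ) * δ by positivity)
      linarith
    refine h1.trans ?_
    rw [hb, add_mul]
    linarith
  have e : D ^ i * U ^ (8 * (r + 1) + t) =
      (D * U ^ (r + 1)) ^ i * ((U ^ (r + 1)) ^ (8 - i) * U ^ t) := by
    obtain ⟨i', hi'⟩ : ∃ i', 8 = i + i' := ⟨8 - i, by omega⟩
    have : 8 - i = i' := by omega
    rw [this, pow_add, pow_mul', hi']
    ring
  rw [e]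
  refine Dom.mono (Bd.mul (Bd.pow hr i)
    (Bd.mul (Bd.pow_one (Bd.pow_one hU1 _) _) (Bd.pow_one hU1 t))) ?_
  rw [mul_one, mul_one]
  refine (pow_le_pow_right₀ hb1 hi).trans (le_of_eq ?_)
  rw [hb, mul_pow, div_pow]
  have e4 : ∀ x : ℝ, 0 ≤ x → √x ^ 8 = x ^ 4 := fun x hx => by
    rw [show √x ^ 8 = (√x ^ 2) ^ 4 by ring, Real.sq_sqrt hx]
  rw [e4 _ (by positivity), e4 _ hpos.le]

end Smoothing

lemma choose_mul_ascending (j k : ℕ) :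
    j.choose k * ((j + 1) * (j + 2) * (j + 3) * (j + 4)) =
      (j + 4).choose (k + 4) * ((k + 1) * (k + 2) * (k + 3) * (k + 4)) := by
  have h1 := Nat.add_one_mul_choose_eq j k
  have h2 := Nat.add_one_mul_choose_eq (j + 1) (k + 1)
  have h3 := Nat.add_one_mul_choose_eq (j + 2) (k + 2)
  have h4 := Nat.add_one_mul_choose_eq (j + 3) (k + 3)
  simp only [add_assoc, Nat.reduceAdd] at h1 h2 h3 h4
  calc _ = ((j + 1) * j.choose k) * ((j + 2) * (j + 3) * (j + 4)) := by ring
    _ = ((j + 2) * (j + 1).choose (k + 1)) * ((k + 1) * (j + 3) * (j + 4)) := by rw [h1]; ring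
    _ = ((j + 3) * (j + 2).choose (k + 2)) * ((k + 1) * (k + 2) * (j + 4)) := by rw [h2]; ring
    _ = ((j + 4) * (j + 3).choose (k + 3)) * ((k + 1) * (k + 2) * (k + 3)) := by rw [h3]; ring
    _ = _ := by rw [h4]; ring

lemma sum_binomial_inv_pow_le {q : ℝ} (hq : 0 < q) (hq1 : q ≤ 1) (j : ℕ) :
    ∑ k ∈ Finset.range (j + 1), (j.choose k : ℝ) * (q ^ k * (1 - q) ^ (j - k) / (k + 1) ^ 4) ≤
      24 / (q ^ 4 * (j + 1) ^ 4) := by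
  have hq' : 0 ≤ 1 - q := by linarith
  set J : ℝ := (j + 1) * (j + 2) * (j + 3) * (j + 4) with hJ
  have hJ0 : 0 < J := by positivity
  have term : ∀ k ∈ Finset.range (j + 1),
      (j.choose k : ℝ) * (q ^ k * (1 - q) ^ (j - k) / (k + 1) ^ 4) ≤
      24 / (q ^ 4 * J) * (q ^ (k + 4) * (1 - q) ^ (j + 4 - (k + 4)) * (j + 4).choose (k + 4)) := by
    intro k hk
    have hc : (j.choose k : ℝ) * J = (j + 4).choose (k + 4) *
        ((k + 1) * (k + 2) * (k + 3) * (k + 4)) := by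
      rw [hJ]; exact_mod_cast choose_mul_ascending j k
    have hk4 : ((k : ℝ) + 1) * (k + 2) * (k + 3) * (k + 4) ≤ 24 * (k + 1) ^ 4 := by
      have hk0 : (0 : ℝ) ≤ k := by positivity
      calc ((k : ℝ) + 1) * (k + 2) * (k + 3) * (k + 4)
          ≤ (k + 1) * (2 * (k + 1)) * (3 * (k + 1)) * (4 * (k + 1)) := by gcongr <;> linarith
        _ = _ := by ring
    have hc' : (j.choose k : ℝ) ≤ (j + 4).choose (k + 4) * (24 * (k + 1) ^ 4) / J := by
      rw [le_div_iff₀ hJ0, hc]; gcongr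
    have hw : 0 ≤ q ^ k * (1 - q) ^ (j - k) / (k + 1) ^ 4 := by positivity
    refine (mul_le_mul_of_nonneg_right hc' hw).trans (le_of_eq ?_)
    rw [Nat.add_sub_add_right, pow_add]
    field_simp
  refine (Finset.sum_le_sum term).trans ?_
  rw [← Finset.mul_sum]
  have hs : ∑ k ∈ Finset.range (j + 1),
      (q ^ (k + 4) * (1 - q) ^ (j + 4 - (k + 4)) * ((j + 4).choose (k + 4) : ℝ)) ≤ 1 := by
    have h := add_pow q (1 - q) (j + 4)
    rw [add_sub_cancel, one_pow, show j + 4 + 1 = 4 + (j + 1) by ring, Finset.sum_range_add] at h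
    refine le_of_le_of_eq ?_ h.symm
    simp only [add_comm 4]
    exact le_add_of_nonneg_left (Finset.sum_nonneg fun i _ => by positivity)
  refine (mul_le_of_le_one_right (by positivity) hs).trans ?_
  gcongr
  calc ((j : ℝ) + 1) ^ 4 = (j + 1) * (j + 1) * (j + 1) * (j + 1) := by ring
    _ ≤ J := by rw [hJ]; gcongr <;> norm_num

section Telescoping

lemma pow_sub_eq_sum {R : Type*} [CommRing R] (T : R) (Q : ℕ → R) (hQ : Q 0 = 1) (n : ℕ) :
    T ^ n - Q n = ∑ j ∈ Finset.range n, T ^ j * (T * Q (n - 1 - j) - Q (n - 1 - j + 1)) := by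
  induction n with
  | zero => simp [hQ]
  | succ n ih =>
    have h : ∀ j ∈ Finset.range n, T ^ (j + 1) * (T * Q (n + 1 - 1 - (j + 1)) -
        Q (n + 1 - 1 - (j + 1) + 1)) = T * (T ^ j * (T * Q (n - 1 - j) - Q (n - 1 - j + 1))) := by
      intro j _
      rw [show n + 1 - 1 - (j + 1) = n - 1 - j by omega]
      ring
    rw [Finset.sum_range_succ', Finset.sum_congr rfl h, ← Finset.mul_sum, ← ih]
    simp only [Nat.add_sub_cancel, Nat.sub_zero]
    ring

/-- The one-step error `T (1 + m β D³) - P (1 + (m + 1) β D³)`. -/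
noncomputable def stepError (T P D : OpRing) (β : ℝ) (m : ℕ) : OpRing :=
  (T - P) * (1 + (m * β) • D ^ 3) - β • (D ^ 3 * P)

variable {T P D L R U V S S₀ : OpRing} {β g c q δ : ℝ} {n : ℕ}

lemma pow_sub_eq_sum_stepError :
    T ^ n - P ^ n * (1 + (n * β) • D ^ 3) =
      ∑ j ∈ Finset.range n, T ^ j * stepError T P D β (n - 1 - j) * P ^ (n - 1 - j) := by
  rw [pow_sub_eq_sum T (fun m => P ^ m * (1 + (m * β) • D ^ 3)) (by simp)]
  refine Finset.sum_congr rfl fun j _ => ?_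
  rw [stepError]
  simp only [Algebra.smul_def, map_mul, map_add, map_natCast, Nat.cast_add, Nat.cast_one, map_one]
  ring

lemma stepError_eq (a : ℝ) (m : ℕ) (X : OpRing) :
    stepError T P D β m * X =
      (T - 1 - a • D ^ 2 - β • D ^ 3) * X - (P - 1 - a • D ^ 2) * X
      + (m * β) • ((T - 1 - a • D ^ 2 - β • D ^ 3) * (D ^ 3 * X) -
          (P - 1 - a • D ^ 2) * (D ^ 3 * X))
      + (m * β ^ 2) • (D ^ 6 * X) - β • ((P - 1 - a • D ^ 2) * (D ^ 3 * X))
      - (β * a) • (D ^ 5 * X) := by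
  rw [stepError]
  simp only [Algebra.smul_def, map_mul, map_natCast, map_pow]
  ring

lemma bd_stepError_mul (hn : 1 ≤ n) (hc : 0 ≤ c) (hg : 0 ≤ g) (hβ : |β| ≤ g / (n * √n))
    (hT : Dom (T - 1 - (1 / (2 * n) : ℝ) • D ^ 2 - β • D ^ 3) (D ^ 4) (c / n ^ 2))
    (hP : Dom (P - 1 - (1 / (2 * n) : ℝ) • D ^ 2) (D ^ 4) (c / n ^ 2))
    {m : ℕ} (hm : m ≤ n) {X : OpRing} {b : ℝ} (hb : 0 ≤ b)
    (hX : ∀ i, 4 ≤ i → i ≤ 7 → Bd (D ^ i * X) b) :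
    Bd (stepError T P D β m * X) ((2 * c + 2 * c * g + g ^ 2 + g * c + g) * b / n ^ 2) := by
  have hn' : (1 : ℝ) ≤ n := by exact_mod_cast hn
  have hm' : (m : ℝ) ≤ n := by exact_mod_cast hm
  have hs : 1 ≤ √(n : ℝ) := Real.one_le_sqrt.2 hn'
  have hβn : |β| ≤ g / n := hβ.trans (by gcongr; nlinarith)
  have hβg : |β| ≤ g := hβn.trans (div_le_self hg hn')
  have hmβ : |m * β| ≤ g := by
    rw [abs_mul, Nat.abs_cast]
    calc (m : ℝ) * |β| ≤ n * (g / n) := by gcongr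
      _ = g := by field_simp
  have hmβ2 : |m * β ^ 2| ≤ g ^ 2 / n ^ 2 := by
    rw [abs_mul, Nat.abs_cast, abs_pow]
    calc (m : ℝ) * |β| ^ 2 ≤ n * (g / (n * √n)) ^ 2 := by gcongr
      _ = g ^ 2 / n ^ 2 := by
        rw [div_pow, mul_pow, Real.sq_sqrt (by positivity)]; field_simp
  have hβa : |β * (1 / (2 * n))| ≤ g / n ^ 2 := by
    rw [abs_mul, abs_of_nonneg (show (0 : ℝ) ≤ 1 / (2 * n) by positivity)]
    calc |β| * (1 / (2 * n)) ≤ g / n * (1 / (1 * n)) := by gcongr; norm_num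
      _ = g / n ^ 2 := by field_simp
  rw [stepError_eq (1 / (2 * n))]
  have h4 := hX 4 le_rfl (by norm_num)
  have h7 : Bd (D ^ 4 * (D ^ 3 * X)) b := by
    rw [← mul_assoc, ← pow_add]; exact hX 7 (by norm_num) le_rfl
  have hT4 := (hT.mul_right X).trans h4
  have hP4 := (hP.mul_right X).trans h4
  have hT7 := (hT.mul_right (D ^ 3 * X)).trans h7
  have hP7 := (hP.mul_right (D ^ 3 * X)).trans h7
  refine Dom.mono (((((hT4.sub hP4).add ((hT7.sub hP7).smul _)).add
    ((hX 6 (by norm_num) (by norm_num)).smul _)).sub (hP7.smul _)).sub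
    ((hX 5 (by norm_num) (by norm_num)).smul _)) ?_
  have hcb : 0 ≤ c / n ^ 2 * b := by positivity
  calc _ ≤ c / n ^ 2 * b + c / n ^ 2 * b + g * (c / n ^ 2 * b + c / n ^ 2 * b) + g ^ 2 / n ^ 2 * b
        + g * (c / n ^ 2 * b) + g / n ^ 2 * b := by gcongr
    _ = _ := by ring

lemma abs_mul_sqrt_pow_le (hn : 1 ≤ n) (hβ : |β| ≤ g / (n * √n)) {m : ℕ} (hm : 1 ≤ m) :
    m * |β| * √(3 * n / m) ^ 3 ≤ 6 * g := by
  have hn' : (1 : ℝ) ≤ n := by exact_mod_cast hn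
  have hm' : (1 : ℝ) ≤ m := by exact_mod_cast hm
  have h1 : √(3 * n / m) ≤ 2 * √n := by
    rw [Real.sqrt_le_left (by positivity), mul_pow, Real.sq_sqrt (by positivity)]
    refine (div_le_self (by positivity) hm').trans ?_
    linarith
  have h2 : √(3 * n / m : ℝ) ^ 3 = 3 * n / m * √(3 * n / m) := by
    rw [pow_succ, Real.sq_sqrt (by positivity)]
  rw [h2]
  have hg : |β| * (n * √n) ≤ g := by rwa [le_div_iff₀ (by positivity)] at hβ
  calc m * |β| * (3 * n / m * √(3 * n / m)) ≤ m * |β| * (3 * n / m * (2 * √n)) := by gcongr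
    _ = 6 * (|β| * (n * √n)) := by field_simp; ring
    _ ≤ _ := by gcongr

lemma bd_stepError_mul_pow (hn : 1 ≤ n) (hg : 0 ≤ g) (hβ : |β| ≤ g / (n * √n))
    (hT1 : Bd T 1) (hP1 : Bd P 1)
    (hD : ∀ m : ℕ, 1 ≤ m → ∀ i : ℕ, Bd (D ^ i * P ^ m) (√(i * n / m) ^ i)) (m : ℕ) :
    Bd (stepError T P D β m * P ^ m) (2 + 18 * g) := by
  have e : stepError T P D β m * P ^ m = (T - P) * (P ^ m + (m * β) • (D ^ 3 * P ^ m))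
      - β • (D ^ 3 * P ^ (m + 1)) := by
    rw [stepError]
    simp only [Algebra.smul_def, map_mul, map_natCast]
    ring
  rw [e]
  have h1 : Bd ((m * β) • (D ^ 3 * P ^ m)) (6 * g) := by
    rcases Nat.eq_zero_or_pos m with rfl | hm
    · intro f M hM x
      have : 0 ≤ M := (abs_nonneg _).trans (hM 0)
      simp only [Nat.cast_zero, zero_mul, zero_smul, map_zero, LinearMap.zero_apply]
      change |(0 : ℝ)| ≤ _
      simp only [abs_zero]
      positivity
    · refine ((hD m hm 3).smul _).mono ?_
      rw [abs_mul, Nat.abs_cast]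
      exact_mod_cast abs_mul_sqrt_pow_le hn hβ hm
  have h2 : Bd (β • (D ^ 3 * P ^ (m + 1))) (6 * g) := by
    refine ((hD (m + 1) (by omega) 3).smul _).mono (le_trans ?_
      (abs_mul_sqrt_pow_le hn hβ (Nat.le_add_left 1 m)))
    have : (1 : ℝ) ≤ ((m + 1 : ℕ) : ℝ) := by exact_mod_cast Nat.le_add_left 1 m
    push_cast at this ⊢
    rw [mul_assoc]
    exact le_mul_of_one_le_left (by positivity) this
  refine Dom.mono ((Bd.mul (hT1.sub hP1) ((Bd.pow_one hP1 m).add h1)).sub h2) ?_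
  linarith

lemma bd_pow_mul_stepError_of_le (hn : 1 ≤ n) (hc : 0 ≤ c) (hg : 0 ≤ g)
    (hβ : |β| ≤ g / (n * √n))
    (hT : Dom (T - 1 - (1 / (2 * n) : ℝ) • D ^ 2 - β • D ^ 3) (D ^ 4) (c / n ^ 2))
    (hP : Dom (P - 1 - (1 / (2 * n) : ℝ) • D ^ 2) (D ^ 4) (c / n ^ 2))
    (hT1 : Bd T 1)
    (hD : ∀ m : ℕ, 1 ≤ m → ∀ i : ℕ, Bd (D ^ i * P ^ m) (√(i * n / m) ^ i)) (j : ℕ)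
    {m : ℕ} (hm : m ≤ n) (hnm : n ≤ 2 * m) :
    Bd (T ^ j * stepError T P D β m * P ^ m)
      ((2 * c + 2 * c * g + g ^ 2 + g * c + g) * 4 ^ 7 / n ^ 2) := by
  have hm1 : 1 ≤ m := by omega
  have hX : ∀ i, 4 ≤ i → i ≤ 7 → Bd (D ^ i * P ^ m) (4 ^ 7) := by
    intro i _ hi
    refine (hD m hm1 i).mono ?_
    have h4 : √(i * n / m : ℝ) ≤ 4 := by
      rw [Real.sqrt_le_left (by norm_num), div_le_iff₀ (by positivity)]
      have : ((i * n : ℕ) : ℝ) ≤ ((16 * m : ℕ) : ℝ) := by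
        exact_mod_cast (Nat.mul_le_mul hi hnm).trans (by omega)
      push_cast at this
      linarith
    exact (pow_le_pow_left₀ (by positivity) h4 i).trans
      (pow_le_pow_right₀ (by norm_num) hi)
  have h := Bd.mul (Bd.pow_one hT1 j) (bd_stepError_mul hn hc hg hβ hT hP hm (by positivity) hX)
  rwa [one_mul, ← mul_assoc] at h

lemma bd_pow_mul_stepError_of_component (hn : 1 ≤ n) (hc : 0 ≤ c) (hg : 0 ≤ g)
    (hβ : |β| ≤ g / (n * √n))
    (hT : Dom (T - 1 - (1 / (2 * n) : ℝ) • D ^ 2 - β • D ^ 3) (D ^ 4) (c / n ^ 2))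
    (hP : Dom (P - 1 - (1 / (2 * n) : ℝ) • D ^ 2) (D ^ 4) (c / n ^ 2))
    (hT1 : Bd T 1) (hP1 : Bd P 1)
    (hD : ∀ m : ℕ, 1 ≤ m → ∀ i : ℕ, Bd (D ^ i * P ^ m) (√(i * n / m) ^ i))
    (hq : 0 < q) (hq1 : q ≤ 1) (hδ : 0 < δ)
    (hTR : T = q • (V * ((1 / 2 : ℝ) • (S + 1))) + R) (hR : Bd R (1 - q))
    (hV : Bd V 1) (hS : Bd S 1) (hS₀ : Bd S₀ 1) (hDV : D * V = (√n / δ) • ((S - 1) * S₀))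
    {j m : ℕ} (hj : j + 1 ≤ n) (hnj : n ≤ 2 * (j + 1)) (hm : m ≤ n) :
    Bd (T ^ j * stepError T P D β m * P ^ m)
      (((2 * c + 2 * c * g + g ^ 2 + g * c + g) * (1 + 6 / δ) ^ 8 + 8 ^ 4 * (2 + 18 * g))
        * 384 / q ^ 4 / n ^ 2) := by
  set C₂ := 2 * c + 2 * c * g + g ^ 2 + g * c + g with hC₂
  set K := (1 + 6 / δ) ^ 8 with hK
  set U := V * ((1 / 2 : ℝ) • (S + 1)) with hU
  have hC₂0 : 0 ≤ C₂ := by positivity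
  have hK0 : 0 ≤ K := by positivity
  have hn' : (1 : ℝ) ≤ n := by exact_mod_cast hn
  have hU1 : Bd U 1 := by
    refine Dom.mono (Bd.mul hV ((hS.add (Dom.refl 1)).smul _)) ?_
    norm_num
  have hk : ∀ k, k ≤ j → Bd (U ^ k * (stepError T P D β m * P ^ m))
      ((C₂ * K + 8 ^ 4 * (2 + 18 * g)) * n ^ 2 / (k + 1) ^ 4) := by
    intro k hkj
    rcases le_or_gt 8 k with h8 | h8
    · have := Bd.mul (bd_stepError_mul hn hc hg hβ hT hP hm
        (b := K * (n ^ 4 / (k + 1) ^ 4)) (by positivity)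
        fun i _ hi => bd_deriv_pow_mul_pow hδ hV hS hS₀ hDV h8 (by omega) (by omega))
        (Bd.pow_one hP1 m)
      rw [mul_one, ← hU, ← hC₂] at this
      rw [mul_left_comm, ← mul_assoc]
      refine this.mono ?_
      calc C₂ * (K * (n ^ 4 / (k + 1) ^ 4)) / n ^ 2 = C₂ * K * n ^ 2 / (k + 1) ^ 4 := by
            field_simp
        _ ≤ _ := by gcongr; linarith
    · have := Bd.mul (Bd.pow_one hU1 k) (bd_stepError_mul_pow hn hg hβ hT1 hP1 hD m)
      refine this.mono ?_
      rw [one_mul, le_div_iff₀ (by positivity)]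
      have hk8 : ((k : ℝ) + 1) ≤ 8 := by exact_mod_cast h8
      have hn2 : (1 : ℝ) ≤ n ^ 2 := one_le_pow₀ hn'
      calc (2 + 18 * g) * ((k : ℝ) + 1) ^ 4 ≤ (2 + 18 * g) * 8 ^ 4 := by gcongr
        _ ≤ (C₂ * K + 8 ^ 4 * (2 + 18 * g)) * 1 := by nlinarith [mul_nonneg hC₂0 hK0]
        _ ≤ _ := by gcongr
  have e : T ^ j * stepError T P D β m * P ^ m = ∑ k ∈ Finset.range (j + 1),
      ((j.choose k : ℝ) * q ^ k) •
        ((U ^ k * (stepError T P D β m * P ^ m)) * R ^ (j - k)) := by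
    conv_lhs => rw [hTR]
    rw [add_pow, Finset.sum_mul, Finset.sum_mul]
    refine Finset.sum_congr rfl fun k _ => ?_
    rw [← hTR]
    rw [smul_pow]
    simp only [Algebra.smul_def, map_mul, map_natCast]
    ring
  rw [e]
  refine Dom.mono (Dom.sum _ fun k hkj =>
    (Bd.mul (hk k (Nat.lt_succ_iff.1 (Finset.mem_range.1 hkj)))
    (Bd.pow hR (j - k))).smul _) ?_
  have hs := mul_le_mul_of_nonneg_left (sum_binomial_inv_pow_le hq hq1 j)
    (show 0 ≤ (C₂ * K + 8 ^ 4 * (2 + 18 * g)) * (n : ℝ) ^ 2 by positivity)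
  have hq' : 0 ≤ 1 - q := by linarith
  refine (le_of_eq ?_).trans (hs.trans ?_)
  · rw [Finset.mul_sum]
    refine Finset.sum_congr rfl fun k _ => ?_
    rw [abs_of_nonneg (by positivity)]
    ring
  · have hnj' : (n : ℝ) ≤ 2 * (j + 1) := by exact_mod_cast hnj
    have h16 : (n : ℝ) ^ 4 ≤ 16 * (j + 1) ^ 4 := by
      calc (n : ℝ) ^ 4 ≤ (2 * (j + 1)) ^ 4 := by gcongr
        _ = _ := by ring
    calc (C₂ * K + 8 ^ 4 * (2 + 18 * g)) * (n : ℝ) ^ 2 * (24 / (q ^ 4 * (j + 1) ^ 4))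
        = (C₂ * K + 8 ^ 4 * (2 + 18 * g)) * (n : ℝ) ^ 2 *
          (24 * 16 / (q ^ 4 * (16 * (j + 1) ^ 4))) := by
          field_simp
      _ ≤ (C₂ * K + 8 ^ 4 * (2 + 18 * g)) * (n : ℝ) ^ 2 * (24 * 16 / (q ^ 4 * n ^ 4)) := by
          gcongr
      _ = _ := by field_simp; norm_num

/-- The constant in the operator form of the expansion. -/
noncomputable def edgeworthConst (c g q δ : ℝ) : ℝ :=
  (2 * c + 2 * c * g + g ^ 2 + g * c + g) * 4 ^ 7 +
    ((2 * c + 2 * c * g + g ^ 2 + g * c + g) * (1 + 6 / δ) ^ 8 + 8 ^ 4 * (2 + 18 * g))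
        * 384 / q ^ 4

theorem bd_pow_sub (hn : 1 ≤ n) (hc : 0 ≤ c) (hg : 0 ≤ g)
    (hβ : |β| ≤ g / (n * √n))
    (hT : Dom (T - 1 - (1 / (2 * n) : ℝ) • D ^ 2 - β • D ^ 3) (D ^ 4) (c / n ^ 2))
    (hP : Dom (P - 1 - (1 / (2 * n) : ℝ) • D ^ 2) (D ^ 4) (c / n ^ 2))
    (hT1 : Bd T 1) (hP1 : Bd P 1)
    (hD : ∀ m : ℕ, 1 ≤ m → ∀ i : ℕ, Bd (D ^ i * P ^ m) (√(i * n / m) ^ i))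
    (hq : 0 < q) (hq1 : q ≤ 1) (hδ : 0 < δ)
    (hTR : T = q • (V * ((1 / 2 : ℝ) • (S + 1))) + R) (hR : Bd R (1 - q))
    (hV : Bd V 1) (hS : Bd S 1) (hS₀ : Bd S₀ 1) (hDV : D * V = (√n / δ) • ((S - 1) * S₀)) :
    Bd (T ^ n - P ^ n * (1 + (n * β) • D ^ 3)) (edgeworthConst c g q δ / n) := by
  rw [pow_sub_eq_sum_stepError]
  refine Dom.mono (Dom.sum _ (c := fun _ => edgeworthConst c g q δ / n ^ 2) fun j hj => ?_) ?_
  · have hj := Finset.mem_range.1 hj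
    rcases le_or_gt n (2 * (n - 1 - j)) with h | h
    · refine (bd_pow_mul_stepError_of_le hn hc hg hβ hT hP hT1 hD j (by omega) h).mono ?_
      rw [edgeworthConst]
      gcongr
      exact le_add_of_nonneg_right (by positivity)
    · refine (bd_pow_mul_stepError_of_component hn hc hg hβ hT hP hT1 hP1 hD hq hq1 hδ hTR hR hV hS
        hS₀ hDV (j := j) (by omega) (by omega) (by omega)).mono ?_
      rw [edgeworthConst]
      gcongr
      exact le_add_of_nonneg_left (by positivity)
  · have hn' : (0 : ℝ) < n := by exact_mod_cast hn
    rw [Finset.sum_const, Finset.card_range, nsmul_eq_mul]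
    refine le_of_eq ?_
    field_simp

end Telescoping

section Taylor

lemma abs_le_of_hasDerivAt_of_abs_le {F F' : ℝ → ℝ} {C : ℝ} {k : ℕ}
    (hF : ∀ y, HasDerivAt F (F' y) y) (hF' : Continuous F') (h0 : F 0 = 0)
    (hC : ∀ y, |F' y| ≤ C * |y| ^ k) (y : ℝ) : |F y| ≤ C / (k + 1) * |y| ^ (k + 1) := by
  have h1 : ∫ t in (0 : ℝ)..1, F' (t * y) * y = F y := by
    rw [intervalIntegral.integral_eq_sub_of_hasDerivAt (f := fun t => F (t * y))]
    · simp [h0]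
    · intro t _
      exact (hF (t * y)).comp t (hasDerivAt_mul_const y)
    · exact Continuous.intervalIntegrable (by fun_prop) _ _
  have h2 := intervalIntegral.norm_integral_le_of_norm_le (μ := volume) (zero_le_one' ℝ)
    (f := fun t => F' (t * y) * y) (g := fun t => C * |y| ^ (k + 1) * t ^ k)
    (.of_forall fun t ht => by
      have := mul_le_mul_of_nonneg_right (hC (t * y)) (abs_nonneg y)
      rw [Real.norm_eq_abs, abs_mul]
      refine this.trans (le_of_eq ?_)
      rw [abs_mul, abs_of_pos ht.1]
      ring)
    (Continuous.intervalIntegrable (by fun_prop) _ _)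
  rw [h1, intervalIntegral.integral_const_mul, integral_pow] at h2
  refine h2.trans (le_of_eq ?_)
  simp
  ring

lemma abs_taylor_remainder_le (g : SmoothJet) {M : ℝ} (hM : ∀ x, |g 4 x| ≤ M) (x y : ℝ) :
    |g 0 (x + y) - g 0 x - y * g 1 x - y ^ 2 / 2 * g 2 x - y ^ 3 / 6 * g 3 x| ≤
      M / 24 * y ^ 4 := by
  have hd : ∀ k y, HasDerivAt (fun y => g k (x + y)) (g (k + 1) (x + y)) y :=
    fun k y => (jet_hasDerivAt g k (x + y)).comp_const_add x y
  have hc : ∀ k, Continuous fun y => g k (x + y) :=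
    fun k => (jet_continuous g k).comp (continuous_const.add continuous_id)
  have h3 := abs_le_of_hasDerivAt_of_abs_le (F := fun y => g 3 (x + y) - g 3 x)
    (F' := fun y => g 4 (x + y)) (C := M) (k := 0)
    (fun y => (hd 3 y).sub_const _) (hc 4) (by simp) (fun y => by simpa using hM _)
  have h2 := abs_le_of_hasDerivAt_of_abs_le (F := fun y => g 2 (x + y) - g 2 x - y * g 3 x)
    (fun y => ((hd 2 y).sub_const _).sub (hasDerivAt_mul_const (g 3 x)))
    ((hc 3).sub continuous_const) (by simp) h3
  have h1 := abs_le_of_hasDerivAt_of_abs_le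
    (F := fun y => g 1 (x + y) - g 1 x - y * g 2 x - y ^ 2 / 2 * g 3 x)
    (fun y => by
      have := (((hd 1 y).sub_const (g 1 x)).sub (hasDerivAt_mul_const (g 2 x))).sub
        (((hasDerivAt_pow 2 y).div_const 2).mul_const (g 3 x))
      refine this.congr_deriv ?_
      norm_num)
    (((hc 2).sub continuous_const).sub (continuous_id.mul continuous_const)) (by simp) h2
  have h0 := abs_le_of_hasDerivAt_of_abs_le
    (F := fun y => g 0 (x + y) - g 0 x - y * g 1 x - y ^ 2 / 2 * g 2 x - y ^ 3 / 6 * g 3 x)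
    (F' := fun y => g 1 (x + y) - g 1 x - y * g 2 x - y ^ 2 / 2 * g 3 x)
    (fun y => by
      have := ((((hd 0 y).sub_const (g 0 x)).sub (hasDerivAt_mul_const (g 1 x))).sub
        (((hasDerivAt_pow 2 y).div_const 2).mul_const (g 2 x))).sub
        (((hasDerivAt_pow 3 y).div_const 6).mul_const (g 3 x))
      refine this.congr_deriv ?_
      push_cast
      ring)
    ((((hc 1).sub continuous_const).sub (continuous_id.mul continuous_const)).sub
      (((continuous_pow 2).div_const 2).mul continuous_const)) (by simp) h1 y
  refine h0.trans (le_of_eq ?_)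
  norm_num
  rw [show |y| ^ 4 = y ^ 4 from Even.pow_abs (by decide) y]
  ring

lemma integrable_pow_of_integrable_pow_four {ρ : Measure ℝ} [IsFiniteMeasure ρ]
    (h4 : Integrable (fun x => x ^ 4) ρ) {k : ℕ} (hk : k ≤ 4) : Integrable (fun x => x ^ k) ρ := by
  refine ((integrable_const (1 : ℝ)).add h4).mono' (by fun_prop) (.of_forall fun x => ?_)
  rw [Real.norm_eq_abs, abs_pow, Pi.add_apply]
  have h0 : 0 ≤ x ^ 4 := by positivity
  rcases le_total |x| 1 with h | h
  · linarith [pow_le_one₀ (n := k) (abs_nonneg x) h]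
  · have := pow_le_pow_right₀ h hk
    rw [show |x| ^ 4 = x ^ 4 from Even.pow_abs (by decide) x] at this
    linarith

lemma dom_taylor (ρ : Measure ℝ) [IsProbabilityMeasure ρ] {γ : ℝ} (h1 : ∫ x, x ∂ρ = 0)
    (h2 : ∫ x, x ^ 2 ∂ρ = 1) (h3 : ∫ x, x ^ 3 ∂ρ = γ) (h4 : Integrable (fun x => x ^ 4) ρ)
    (c : ℝ) :
    Dom (opT (ρ.map (c * ·)) - 1 - (c ^ 2 / 2) • opD ^ 2 - (γ * c ^ 3 / 6) • opD ^ 3) (opD ^ 4)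
      (c ^ 4 * (∫ x, x ^ 4 ∂ρ) / 24) := by
  intro g M hM x
  have hM' : ∀ x, |g 4 x| ≤ M := hM
  have e : (act (opT (ρ.map (c * ·)) - 1 - (c ^ 2 / 2) • opD ^ 2 -
      (γ * c ^ 3 / 6) • opD ^ 3) g) 0 x =
      (∫ y, g 0 (x + c * y) ∂ρ) - g 0 x - c ^ 2 / 2 * g 2 x - γ * c ^ 3 / 6 * g 3 x := by
    have : ∫ y, g 0 (x + y) ∂(ρ.map (c * ·)) = ∫ y, g 0 (x + c * y) ∂ρ :=
      integral_map (by fun_prop) (jet_integrable_shift g 0 x _).aestronglyMeasurable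
    rw [← this]
    rfl
  have i0 : Integrable (fun y => g 0 (x + c * y)) ρ := by
    obtain ⟨C, hC⟩ := jet_exists_bound g 0
    have := jet_continuous g 0
    exact Integrable.of_bound (by fun_prop) C (.of_forall fun y => hC _)
  have i1 : Integrable (fun y : ℝ => y) ρ := by
    simpa using integrable_pow_of_integrable_pow_four h4 (show 1 ≤ 4 by norm_num)
  have i2 := integrable_pow_of_integrable_pow_four h4 (show 2 ≤ 4 by norm_num)
  have i3 := integrable_pow_of_integrable_pow_four h4 (show 3 ≤ 4 by norm_num)
  have e2 : (∫ y, g 0 (x + c * y) ∂ρ) - g 0 x - c ^ 2 / 2 * g 2 x - γ * c ^ 3 / 6 * g 3 x =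
      ∫ y, (g 0 (x + c * y) - g 0 x - y * (c * g 1 x) - y ^ 2 * (c ^ 2 / 2 * g 2 x)
        - y ^ 3 * (c ^ 3 / 6 * g 3 x)) ∂ρ := by
    have j1 := i0.sub (integrable_const (g 0 x))
    have j2 := j1.sub (i1.mul_const (c * g 1 x))
    have j3 := j2.sub (i2.mul_const (c ^ 2 / 2 * g 2 x))
    have k3 := integral_sub j3 (i3.mul_const (c ^ 3 / 6 * g 3 x))
    have k2 := integral_sub j2 (i2.mul_const (c ^ 2 / 2 * g 2 x))
    have k1 := integral_sub j1 (i1.mul_const (c * g 1 x))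
    have k0 := integral_sub i0 (integrable_const (g 0 x))
    simp only [Pi.sub_apply] at k0 k1 k2 k3
    rw [k3, k2, k1, k0, integral_mul_const, integral_mul_const, integral_mul_const, h1, h2, h3,
      integral_const]
    simp
    ring
  rw [e, e2]
  rw [← Real.norm_eq_abs]
  refine (norm_integral_le_of_norm_le (h4.const_mul (M / 24 * c ^ 4))
    (.of_forall fun y => ?_)).trans (le_of_eq ?_)
  · have := abs_taylor_remainder_le g hM' x (c * y)
    rw [Real.norm_eq_abs]
    refine le_trans (le_of_eq ?_) (this.trans (le_of_eq ?_))
    · congr 1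
      ring
    · ring
  · rw [integral_const_mul]
    ring

end Taylor

section Gaussian

open Polynomial in
lemma integrable_eval_gaussian (p : ℝ[X]) : Integrable (fun z => p.eval z) (gaussianReal 0 1) := by
  induction p using Polynomial.induction_on' with
  | add p q hp hq =>
    simp only [eval_add]
    exact hp.add hq
  | monomial k a =>
    simp only [eval_monomial]
    refine Integrable.const_mul ?_ a
    have := (memLp_id_gaussianReal (μ := 0) (v := 1) k).integrable_norm_pow'
    refine this.mono' (by fun_prop) (.of_forall fun x => ?_)
    simp

lemma hasDerivAt_gaussianPDFReal (x : ℝ) :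
    HasDerivAt (gaussianPDFReal 0 1) (-x * gaussianPDFReal 0 1 x) x := by
  have h : HasDerivAt (fun x : ℝ => -(x - 0) ^ 2 / (2 * ((1 : NNReal) : ℝ))) (-x) x := by
    have := (((hasDerivAt_id x).sub_const 0).pow 2).neg.div_const (2 * ((1 : NNReal) : ℝ))
    refine this.congr_deriv ?_
    simp
    ring
  refine ((h.exp).const_mul (√(2 * Real.pi * ((1 : NNReal) : ℝ)))⁻¹).congr_deriv ?_
  rw [gaussianPDFReal]
  ring

lemma integrable_gaussian_iff {f : ℝ → ℝ} :
    Integrable f (gaussianReal 0 1) ↔ Integrable fun x => gaussianPDFReal 0 1 x * f x := by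
  rw [gaussianReal_of_var_ne_zero 0 one_ne_zero, integrable_withDensity_iff_integrable_smul'
    (measurable_gaussianPDF 0 1) (.of_forall fun _ => gaussianPDF_lt_top)]
  simp [toReal_gaussianPDF]

open Polynomial in
lemma integrable_eval_mul_jet (p : ℝ[X]) (g : SmoothJet) (k : ℕ) (x c : ℝ) :
    Integrable (fun z => p.eval z * g k (x + c * z)) (gaussianReal 0 1) := by
  obtain ⟨C, hC⟩ := jet_exists_bound g k
  have := jet_continuous g k
  exact (integrable_eval_gaussian p).mul_bdd (c := C) (by fun_prop) (.of_forall fun z => hC _)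

open Polynomial in
lemma integral_eval_mul_jet_succ (p : ℝ[X]) (g : SmoothJet) (k : ℕ) (x c : ℝ) :
    c * ∫ z, p.eval z * g (k + 1) (x + c * z) ∂(gaussianReal 0 1) =
      ∫ z, (X * p - derivative p).eval z * g k (x + c * z) ∂(gaussianReal 0 1) := by
  have h := integral_mul_deriv_eq_deriv_mul_of_integrable
    (u := fun z => p.eval z * gaussianPDFReal 0 1 z) (v := fun z => g k (x + c * z))
    (u' := fun z => (derivative p - X * p).eval z * gaussianPDFReal 0 1 z)
    (v' := fun z => g (k + 1) (x + c * z) * c)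
    (fun z _ => ((p.hasDerivAt z).mul (hasDerivAt_gaussianPDFReal z)).congr_deriv
      (by simp only [eval_sub, eval_mul, eval_X]; ring))
    (fun z _ => (jet_hasDerivAt g k (x + c * z)).comp z
      (((hasDerivAt_id z).const_mul c).const_add x |>.congr_deriv (mul_one c)))
    (by
      refine ((integrable_gaussian_iff.1 (integrable_eval_mul_jet p g (k + 1) x c)).mul_const
        c).congr (.of_forall fun z => ?_)
      simp only [Pi.mul_apply]; ring)
    (by
      refine (integrable_gaussian_iff.1
        (integrable_eval_mul_jet (derivative p - X * p) g k x c)).congr (.of_forall fun z => ?_)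
      simp only [Pi.mul_apply]; ring)
    (by
      refine (integrable_gaussian_iff.1 (integrable_eval_mul_jet p g k x c)).congr
        (.of_forall fun z => ?_)
      simp only [Pi.mul_apply]; ring)
  rw [integral_gaussianReal_eq_integral_smul one_ne_zero,
    integral_gaussianReal_eq_integral_smul one_ne_zero, ← integral_const_mul]
  rw [← integral_neg] at h
  refine Eq.trans (integral_congr_ae (.of_forall fun z => ?_))
    (h.trans (integral_congr_ae (.of_forall fun z => ?_)))
  · simp only [smul_eq_mul]
    ring
  · simp only [smul_eq_mul, eval_sub]
    ring

lemma integral_gaussian_third_deriv (g : SmoothJet) :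
    ∫ z, g 3 z ∂(gaussianReal 0 1) = ∫ z, (z ^ 3 - 3 * z) * g 0 z ∂(gaussianReal 0 1) := by
  have h1 := integral_eval_mul_jet_succ 1 g 2 0 1
  have h2 := integral_eval_mul_jet_succ .X g 1 0 1
  have h3 := integral_eval_mul_jet_succ (.X ^ 2 - 1) g 0 0 1
  simp only [one_mul, zero_add, Polynomial.eval_one, mul_one, Polynomial.derivative_one, sub_zero,
    Polynomial.derivative_X, ← sq] at h1 h2 h3
  rw [h1, h2, h3]
  refine integral_congr_ae (.of_forall fun z => ?_)
  simp
  left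
  ring

lemma integral_sq_gaussian : ∫ z, z ^ 2 ∂(gaussianReal 0 1) = 1 := by
  have h := variance_fun_id_gaussianReal (μ := 0) (v := 1)
  rw [variance_eq_integral measurable_id'.aemeasurable] at h
  simpa [integral_id_gaussianReal] using h

lemma integral_cube_gaussian : ∫ z, z ^ 3 ∂(gaussianReal 0 1) = 0 := by
  have h : ∫ z, z ^ 3 ∂((gaussianReal 0 1).map fun z => -z) = ∫ z, (-z) ^ 3 ∂(gaussianReal 0 1) :=
    integral_map (by fun_prop) (by fun_prop)
  rw [gaussianReal_map_neg, neg_zero] at h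
  have h2 : ∫ z : ℝ, (-z) ^ 3 ∂(gaussianReal 0 1) = -∫ z, z ^ 3 ∂(gaussianReal 0 1) := by
    rw [← integral_neg]
    exact integral_congr_ae (.of_forall fun z => by ring)
  linarith

lemma integral_abs_gaussian_le : ∫ z, |z| ∂(gaussianReal 0 1) ≤ 1 := by
  have i1 : Integrable (fun z : ℝ => z) (gaussianReal 0 1) := by
    simpa using integrable_eval_gaussian .X
  have i2 : Integrable (fun z : ℝ => z ^ 2) (gaussianReal 0 1) := by
    exact (integrable_eval_gaussian (Polynomial.X ^ 2)).congr (.of_forall fun z => by simp)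
  have h : ∫ z, |z| ∂(gaussianReal 0 1) ≤ ∫ z : ℝ, ((1 / 2 : ℝ) + z ^ 2 / 2) ∂(gaussianReal 0 1) :=
    integral_mono i1.abs ((integrable_const _).add (i2.div_const 2)) fun z => by
      simp only
      nlinarith [sq_nonneg (|z| - 1), sq_abs z]
  have h2 := integral_add (μ := gaussianReal 0 1) (integrable_const (1 / 2 : ℝ)) (i2.div_const 2)
  rw [integral_div 2 (fun z : ℝ => z ^ 2), integral_sq_gaussian, integral_const] at h2
  simp only [probReal_univ, one_smul] at h2
  linarith

lemma opT_conv (ρ σ : Measure ℝ) [IsFiniteMeasure ρ] [IsFiniteMeasure σ] :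
    opT (ρ ∗ σ) = opT ρ * opT σ :=
  act_injective (by rw [map_mul]; exact convOp_conv ρ σ)

lemma opT_congr {ρ σ : Measure ℝ} [IsFiniteMeasure ρ] [IsFiniteMeasure σ] (h : ρ = σ) :
    opT ρ = opT σ := by
  subst h; rfl

lemma opT_add (ρ σ : Measure ℝ) [IsFiniteMeasure ρ] [IsFiniteMeasure σ] :
    opT (ρ + σ) = opT ρ + opT σ :=
  act_injective (by rw [map_add]; exact convOp_add ρ σ)

lemma opT_dirac_zero : opT (Measure.dirac 0) = 1 := act_injective <| by
  ext g k x
  rw [act_opT, convOp_apply, integral_dirac, add_zero, map_one]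
  rfl

lemma opT_gaussianReal_pow (v : NNReal) (k : ℕ) :
    opT (gaussianReal 0 v) ^ k = opT (gaussianReal 0 (k * v)) := by
  induction k with
  | zero =>
    rw [pow_zero, ← opT_dirac_zero]
    exact opT_congr (by simp [gaussianReal_zero_var])
  | succ k ih =>
    rw [pow_succ, ih, ← opT_conv]
    refine opT_congr ?_
    rw [gaussianReal_conv_gaussianReal, add_zero]
    congr 1
    push_cast
    ring

lemma gaussianReal_map_sqrt_mul (v : NNReal) :
    (gaussianReal 0 1).map (√v * ·) = gaussianReal 0 v := by
  rw [gaussianReal_map_const_mul]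
  congr 1
  · simp
  · ext; simp

lemma bd_opD_mul_gaussian {v : NNReal} (hv : 0 < v) :
    Bd (opD * opT (gaussianReal 0 v)) (1 / √v) := by
  intro g M hM x
  have hM' : ∀ x, |g 0 x| ≤ M := hM
  have hs : 0 < √(v : ℝ) := Real.sqrt_pos.2 hv
  have e : (act (opD * opT (gaussianReal 0 v)) g) 0 x =
      ∫ z, g 1 (x + √v * z) ∂(gaussianReal 0 1) := by
    have : ∫ y, g 1 (x + y) ∂(gaussianReal 0 v) = ∫ z, g 1 (x + √v * z) ∂(gaussianReal 0 1) := by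
      rw [← gaussianReal_map_sqrt_mul]
      exact integral_map (by fun_prop) (jet_integrable_shift g 1 x _).aestronglyMeasurable
    exact this
  have h1 := integral_eval_mul_jet_succ 1 g 0 x √v
  simp only [zero_add, Polynomial.eval_one, one_mul, mul_one, Polynomial.derivative_one, sub_zero,
    Polynomial.eval_X] at h1
  have i1 : Integrable (fun z : ℝ => z) (gaussianReal 0 1) := by
    simpa using integrable_eval_gaussian .X
  have h2 : |∫ z, z * g 0 (x + √v * z) ∂(gaussianReal 0 1)| ≤ M := by
    rw [← Real.norm_eq_abs]
    refine (norm_integral_le_of_norm_le (i1.abs.mul_const M) (.of_forall fun z => ?_)).trans ?_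
    · rw [Real.norm_eq_abs, abs_mul]
      exact mul_le_mul_of_nonneg_left (hM' _) (abs_nonneg z)
    · rw [integral_mul_const]
      exact mul_le_of_le_one_left ((abs_nonneg _).trans (hM 0)) integral_abs_gaussian_le
  rw [e, one_div, le_inv_mul_iff₀ hs]
  rwa [← h1, abs_mul, abs_of_pos hs] at h2

lemma bd_opD_pow_mul_gaussian_pow {n m : ℕ} (hn : 1 ≤ n) (hm : 1 ≤ m) (i : ℕ) :
    Bd (opD ^ i * opT (gaussianReal 0 (1 / n : NNReal)) ^ m) (√(i * n / m) ^ i) := by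
  rcases Nat.eq_zero_or_pos i with rfl | hi
  · simpa using Bd.pow_one (bd_opT_prob _) m
  have hn' : (0 : NNReal) < n := by exact_mod_cast hn
  have hm' : (0 : NNReal) < m := by exact_mod_cast hm
  have hi' : (0 : NNReal) < i := by exact_mod_cast hi
  have e : opT (gaussianReal 0 (1 / n : NNReal)) ^ m =
      opT (gaussianReal 0 (m / (i * n) : NNReal)) ^ i := by
    rw [opT_gaussianReal_pow, opT_gaussianReal_pow]
    refine opT_congr ?_
    congr 1
    field_simp
  rw [e, ← mul_pow]
  have h := Bd.pow (bd_opD_mul_gaussian (v := m / (i * n)) (by positivity)) i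
  refine h.mono (le_of_eq ?_)
  congr 1
  push_cast
  rw [one_div, ← Real.sqrt_inv, inv_div]

end Gaussian

section Component

/-- The measure with constant density `κ` on `(a, b]`. -/
noncomputable def uniformPart (κ : NNReal) (a b : ℝ) : Measure ℝ :=
  κ • volume.restrict (Set.Ioc a b)

noncomputable instance (κ : NNReal) (a b : ℝ) : IsFiniteMeasure (uniformPart κ a b) := by
  unfold uniformPart; infer_instance

lemma integral_uniformPart (κ : NNReal) {a b : ℝ} (hab : a ≤ b) (f : ℝ → ℝ) :
    ∫ y, f y ∂(uniformPart κ a b) = κ * ∫ y in a..b, f y := by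
  rw [uniformPart, integral_smul_nnreal_measure, intervalIntegral.integral_of_le hab]
  rfl

lemma uniformPart_real_univ (κ : NNReal) {a b : ℝ} (hab : a ≤ b) :
    (uniformPart κ a b).real Set.univ = κ * (b - a) := by
  have := integral_uniformPart κ hab (fun _ => 1)
  simpa using this

lemma act_opT_map_apply (ρ : Measure ℝ) [IsFiniteMeasure ρ] (c : ℝ) (g : SmoothJet) (k : ℕ)
    (x : ℝ) : (act (opT (ρ.map (c * ·))) g) k x = ∫ y, g k (x + c * y) ∂ρ :=
  integral_map (by fun_prop) (jet_integrable_shift g k x _).aestronglyMeasurable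

lemma act_opT_dirac_apply (y : ℝ) (g : SmoothJet) (k : ℕ) (x : ℝ) :
    (act (opT (Measure.dirac y)) g) k x = g k (x + y) := by
  rw [act_opT, convOp_apply, integral_dirac]

lemma uniformPart_le {p a b c : ℝ} {μ ν : Measure ℝ} {d : ℝ → ℝ≥0∞}
    (hν : ν = volume.withDensity d) (hd : ∀ x ∈ Set.Icc a b, ENNReal.ofReal c ≤ d x)
    (hμ : ENNReal.ofReal p • ν ≤ μ) : uniformPart (p.toNNReal * c.toNNReal) a b ≤ μ := by
  refine le_trans (Measure.le_iff.2 fun s hs => ?_) hμ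
  rw [hν, Measure.smul_apply, withDensity_apply _ hs, uniformPart, Measure.smul_apply,
    Measure.restrict_apply hs, mul_smul, smul_eq_mul]
  change ENNReal.ofReal p * (ENNReal.ofReal c * _) ≤ _
  gcongr
  calc ENNReal.ofReal c * volume (s ∩ Set.Ioc a b)
      = ∫⁻ _ in s ∩ Set.Ioc a b, ENNReal.ofReal c := by rw [setLIntegral_const]
    _ ≤ ∫⁻ x in s ∩ Set.Ioc a b, d x :=
      setLIntegral_mono' (hs.inter measurableSet_Ioc) fun x hx => hd x ⟨hx.2.1.le, hx.2.2⟩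
    _ ≤ _ := lintegral_mono_set Set.inter_subset_left

lemma opT_map_add (ρ σ : Measure ℝ) [IsFiniteMeasure ρ] [IsFiniteMeasure σ] (c : ℝ) :
    opT ((ρ + σ).map (c * ·)) = opT (ρ.map (c * ·)) + opT (σ.map (c * ·)) := by
  rw [← opT_add]
  exact opT_congr (Measure.map_add _ _ (by fun_prop))

variable {μ : Measure ℝ} [IsProbabilityMeasure μ] {κ : NNReal} {a b : ℝ}

lemma uniformPart_mass_le (hab : a < b) (hμ : uniformPart κ a b ≤ μ) : κ * (b - a) ≤ 1 := by
  rw [← uniformPart_real_univ κ hab.le, ← probReal_univ (μ := μ)]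
  exact ENNReal.toReal_mono (measure_ne_top _ _) (hμ _)

lemma exists_component_decomposition (hab : a < b) (hμ : uniformPart κ a b ≤ μ) {r : ℝ}
    (hr : 0 < r) :
    ∃ V S S₀ R : OpRing,
      opT (μ.map (r⁻¹ * ·)) = (κ * (b - a)) • (V * ((1 / 2 : ℝ) • (S + 1))) + R ∧
      Bd R (1 - κ * (b - a)) ∧ Bd V 1 ∧ Bd S 1 ∧ Bd S₀ 1 ∧
      opD * V = (r / ((b - a) / 2)) • ((S - 1) * S₀) := by
  set δ := (b - a) / 2 with hδ
  have hδ0 : 0 < δ := by rw [hδ]; linarith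
  have hbδ : b = a + δ + δ := by rw [hδ]; ring
  have haδ : a ≤ a + δ := by linarith
  have h1δ : ((1 / δ).toNNReal : ℝ) = 1 / δ := Real.coe_toNNReal _ (by positivity)
  refine ⟨opT ((uniformPart (1 / δ).toNNReal a (a + δ)).map (r⁻¹ * ·)),
    opT (Measure.dirac (r⁻¹ * δ)), opT (Measure.dirac (r⁻¹ * a)),
    opT ((μ - uniformPart κ a b).map (r⁻¹ * ·)), ?_, ?_, ?_, bd_opT_prob _, bd_opT_prob _, ?_⟩
  · have e : opT (μ.map (r⁻¹ * ·)) =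
        opT ((uniformPart κ a b + (μ - uniformPart κ a b)).map (r⁻¹ * ·)) :=
      opT_congr (by rw [add_comm, Measure.sub_add_cancel_of_le hμ])
    rw [e, opT_map_add]
    congr 1
    refine act_injective ?_
    ext g k x
    have hii : ∀ u v : ℝ, IntervalIntegrable (fun y => g k (x + r⁻¹ * y)) volume u v := fun u v =>
      ((jet_continuous g k).comp (by fun_prop : Continuous fun y => x + r⁻¹ * y)).intervalIntegrable
        _ _
    have hshift : ∫ y in a..(a + δ), g k (x + r⁻¹ * y + r⁻¹ * δ) =
        ∫ y in (a + δ)..b, g k (x + r⁻¹ * y) := by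
      rw [hbδ, ← intervalIntegral.integral_comp_add_right]
      exact intervalIntegral.integral_congr fun y _ => congrArg (g k) (by ring)
    have e1 : (act ((κ * (b - a)) • (opT ((uniformPart (1 / δ).toNNReal a (a + δ)).map (r⁻¹ * ·)) *
        ((1 / 2 : ℝ) • (opT (Measure.dirac (r⁻¹ * δ)) + 1)))) g) k x =
        κ * (b - a) * ∫ y, (1 / 2) * ((act (opT (Measure.dirac (r⁻¹ * δ))) g) k (x + r⁻¹ * y)
          + g k (x + r⁻¹ * y)) ∂(uniformPart (1 / δ).toNNReal a (a + δ)) := by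
      rw [map_smul, LinearMap.smul_apply, SmoothJet.smul_apply, map_mul, Module.End.mul_apply,
        act_opT_map_apply, map_smul, map_add, map_one]
      rfl
    rw [e1, act_opT_map_apply, integral_uniformPart _ hab.le]
    simp only [act_opT_dirac_apply]
    have hii' : IntervalIntegrable (fun y => g k (x + r⁻¹ * y + r⁻¹ * δ)) volume a (a + δ) :=
      ((jet_continuous g k).comp
        (by fun_prop : Continuous fun y => x + r⁻¹ * y + r⁻¹ * δ)).intervalIntegrable _ _
    rw [integral_uniformPart _ haδ, intervalIntegral.integral_const_mul,
      intervalIntegral.integral_add hii' (hii _ _), hshift, add_comm,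
      intervalIntegral.integral_add_adjacent_intervals (hii _ _) (hii _ _), h1δ,
      show b - a = 2 * δ by rw [hδ]; ring]
    field_simp
  · refine (bd_opT _).mono (le_of_eq ?_)
    rw [map_measureReal_apply (by fun_prop) MeasurableSet.univ, Set.preimage_univ,
      ← uniformPart_real_univ κ hab.le, ← probReal_univ (μ := μ)]
    nth_rewrite 2 [← Measure.sub_add_cancel_of_le hμ]
    rw [measureReal_add_apply]
    ring
  · refine (bd_opT _).mono (le_of_eq ?_)
    rw [map_measureReal_apply (by fun_prop) MeasurableSet.univ, Set.preimage_univ,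
      uniformPart_real_univ _ haδ, h1δ]
    field_simp
    ring
  · refine act_injective ?_
    ext g k x
    have e1 : (act ((r / δ) • ((opT (Measure.dirac (r⁻¹ * δ)) - 1) *
        opT (Measure.dirac (r⁻¹ * a)))) g) k x = r / δ *
        ((act (opT (Measure.dirac (r⁻¹ * δ))) (act (opT (Measure.dirac (r⁻¹ * a))) g)) k x -
          (act (opT (Measure.dirac (r⁻¹ * a))) g) k x) := by
      rw [map_smul, LinearMap.smul_apply, SmoothJet.smul_apply, map_mul, Module.End.mul_apply,
        map_sub, map_one]
      rfl
    rw [e1]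
    simp only [act_opT_dirac_apply]
    rw [map_mul, Module.End.mul_apply, act_opD, derivOp_apply, act_opT_map_apply,
      integral_uniformPart _ haδ, h1δ]
    have hint : ∫ y in a..(a + δ), g (k + 1) (x + r⁻¹ * y) =
        r * g k (x + r⁻¹ * (a + δ)) - r * g k (x + r⁻¹ * a) := by
      refine intervalIntegral.integral_eq_sub_of_hasDerivAt
        (f := fun y => r * g k (x + r⁻¹ * y)) (fun y _ => ?_)
        (((jet_continuous g (k + 1)).comp
          (by fun_prop : Continuous fun y => x + r⁻¹ * y)).intervalIntegrable _ _)
      have := ((jet_hasDerivAt g k (x + r⁻¹ * y)).comp y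
        (((hasDerivAt_id y).const_mul r⁻¹).const_add x)).const_mul r
      refine this.congr_deriv ?_
      field_simp
    rw [hint, show x + r⁻¹ * δ + r⁻¹ * a = x + r⁻¹ * (a + δ) by ring]
    ring

end Component

section Approximation

/-- A compactly supported smooth function, with its derivatives. -/
noncomputable def SmoothJet.ofCompactSupport (f : ℝ → ℝ) (hf : ContDiff ℝ (⊤ : ℕ∞) f)
    (hs : HasCompactSupport f) : SmoothJet :=
  ⟨fun k => iteratedDeriv k f, by
    have hdiff : ∀ k, Differentiable ℝ (iteratedDeriv k f) := fun k =>
      hf.differentiable_iteratedDeriv k (by exact_mod_cast WithTop.coe_lt_top k)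
    have hsupp : ∀ k, HasCompactSupport (iteratedDeriv k f) := fun k => by
      induction k with
      | zero => simpa using hs
      | succ k ih => rw [iteratedDeriv_succ]; exact ih.deriv
    refine ⟨fun k x => ?_, fun k => (hdiff k).continuous.bounded_above_of_compact_support (hsupp k)⟩
    have h := (hdiff k x).hasDerivAt
    rwa [← iteratedDeriv_succ] at h⟩

lemma SmoothJet.ofCompactSupport_zero (f : ℝ → ℝ) (hf : ContDiff ℝ (⊤ : ℕ∞) f)
    (hs : HasCompactSupport f) : (SmoothJet.ofCompactSupport f hf hs) 0 = f :=
  iteratedDeriv_zero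

lemma exists_smoothJet_integral_sub_le (m : Measure ℝ) [IsFiniteMeasure m] {h : ℝ → ℝ}
    (hm : Measurable h) (h1 : ∀ x, |h x| ≤ 1) {ε : ℝ} (hε : 0 < ε) :
    ∃ g : SmoothJet, (∀ x, |g 0 x| ≤ 1) ∧ ∫ x, |h x - g 0 x| ∂m ≤ ε := by
  have hint : Integrable h m := Integrable.of_bound hm.aestronglyMeasurable 1 (.of_forall h1)
  set M : ℝ := m.real Set.univ with hM
  have hM0 : 0 ≤ M := measureReal_nonneg
  obtain ⟨f, fs, hf, fc, fi⟩ := hint.exists_hasCompactSupport_integral_sub_le (half_pos hε)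
  set η : ℝ := ε / 2 / (2 * M + 1) with hη
  have hη0 : 0 < η := by positivity
  obtain ⟨s, sd, hs, ss⟩ := (show Continuous fun x => max (-1) (min 1 (f x)) by
    fun_prop).exists_contDiff_approx ⊤ (ε := fun _ => η) (by fun_prop) (fun _ => hη0)
  have scs : HasCompactSupport s := by
    refine (fs.comp_left (g := fun y : ℝ => max (-1) (min 1 y)) (by simp)).mono' ?_
    exact ss.trans subset_closure
  have hclip : ∀ x, |max (-1) (min 1 (f x))| ≤ 1 := fun x =>
    abs_le.2 ⟨le_max_left _ _, max_le (by norm_num) (min_le_left _ _)⟩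
  have hs1 : ∀ x, |s x| ≤ 1 + η := fun x => by
    have h1 := hs x
    rw [Real.dist_eq] at h1
    have := abs_sub_abs_le_abs_sub (s x) (max (-1) (min 1 (f x)))
    linarith [hclip x]
  refine ⟨(1 / (1 + η)) • SmoothJet.ofCompactSupport s sd scs, fun x => ?_, ?_⟩
  · rw [SmoothJet.smul_apply, SmoothJet.ofCompactSupport_zero, abs_mul,
      abs_of_pos (show 0 < 1 / (1 + η) by positivity), one_div, inv_mul_le_iff₀ (by positivity)]
    linarith [hs1 x]
  · have key : ∀ x, |h x - ((1 / (1 + η)) • SmoothJet.ofCompactSupport s sd scs) 0 x| ≤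
        ‖h x - f x‖ + 2 * η := by
      intro x
      rw [SmoothJet.smul_apply, SmoothJet.ofCompactSupport_zero]
      have e1 : |h x - max (-1) (min 1 (f x))| ≤ |h x - f x| := by
        have e : h x = max (-1) (min 1 (h x)) := by
          rw [min_eq_right (abs_le.1 (h1 x)).2, max_eq_right (abs_le.1 (h1 x)).1]
        calc |h x - max (-1) (min 1 (f x))|
            = |max (-1) (min 1 (h x)) - max (-1) (min 1 (f x))| := by rw [← e]
          _ ≤ |min 1 (h x) - min 1 (f x)| := by
            simpa using abs_max_sub_max_le_max (-1) (min 1 (h x)) (-1) (min 1 (f x))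
          _ ≤ |h x - f x| := by simpa using abs_min_sub_min_le_max 1 (h x) 1 (f x)
      have e2 : |max (-1) (min 1 (f x)) - s x| ≤ η := by
        have := (hs x).le
        rwa [dist_comm, Real.dist_eq] at this
      have e3 : |s x - 1 / (1 + η) * s x| ≤ η := by
        rw [show s x - 1 / (1 + η) * s x = η / (1 + η) * s x by field_simp; ring, abs_mul,
          abs_of_pos (by positivity), div_mul_eq_mul_div, div_le_iff₀ (by positivity)]
        exact mul_le_mul_of_nonneg_left (hs1 x) hη0.le
      have := abs_sub_le (h x) (max (-1) (min 1 (f x))) (1 / (1 + η) * s x)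
      have := abs_sub_le (max (-1) (min 1 (f x))) (s x) (1 / (1 + η) * s x)
      rw [Real.norm_eq_abs]
      linarith
    have i1 := (hint.sub fi).norm
    have hle := integral_mono_of_nonneg (μ := m) (.of_forall fun x => abs_nonneg _)
      (i1.add (integrable_const (2 * η))) (.of_forall key)
    refine hle.trans ?_
    have h2 : ∫ x, (‖h x - f x‖ + 2 * η) ∂m = ∫ x, ‖h x - f x‖ ∂m + M * (2 * η) := by
      have := integral_add i1 (integrable_const (2 * η))
      rw [integral_const, smul_eq_mul] at this
      exact this
    have h3 : M * (2 * η) ≤ ε / 2 := by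
      rw [hη, show M * (2 * (ε / 2 / (2 * M + 1))) = ε / 2 * (2 * M) / (2 * M + 1) by ring,
        div_le_iff₀ (by positivity)]
      nlinarith
    change ∫ x, (‖h x - f x‖ + 2 * η) ∂m ≤ ε
    linarith

/-- The signed error of the expansion with coefficient `t` for the law `σ`. -/
noncomputable def expansionError (σ : Measure ℝ) (t : ℝ) (h : ℝ → ℝ) : ℝ :=
  ∫ x, h x ∂σ - ∫ z, h z ∂(gaussianReal 0 1) -
    t * ∫ z, (z ^ 3 - 3 * z) * h z ∂(gaussianReal 0 1)

lemma integrable_hermite_gaussian :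
    Integrable (fun z : ℝ => z ^ 3 - 3 * z) (gaussianReal 0 1) :=
  (integrable_eval_gaussian (.X ^ 3 - 3 * .X)).congr (.of_forall fun z => by simp)

lemma abs_expansionError_le_of_smooth (σ : Measure ℝ) [IsProbabilityMeasure σ] {t K : ℝ}
    (hK : ∀ g : SmoothJet, (∀ x, |g 0 x| ≤ 1) → |expansionError σ t (g 0)| ≤ K)
    {h : ℝ → ℝ} (hm : Measurable h) (h1 : ∀ x, |h x| ≤ 1) : |expansionError σ t h| ≤ K := by
  refine le_of_forall_pos_le_add fun ε hε => ?_
  set H : ℝ → ℝ := fun z => z ^ 3 - 3 * z with hH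
  have hHi : Integrable H (gaussianReal 0 1) := integrable_hermite_gaussian
  have hHm : Measurable fun z => ENNReal.ofReal |H z| := by fun_prop
  set ω : Measure ℝ := (gaussianReal 0 1).withDensity fun z => ENNReal.ofReal |H z| with hω
  have : IsFiniteMeasure ω := isFiniteMeasure_withDensity_ofReal hHi.abs.2
  obtain ⟨g, hg1, hg⟩ := exists_smoothJet_integral_sub_le (σ + gaussianReal 0 1 + ω) hm h1
    (show 0 < ε / (1 + |t|) by positivity)
  have gc := jet_continuous g 0
  have hi : ∀ (m : Measure ℝ) [IsFiniteMeasure m], Integrable h m := fun m _ =>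
    Integrable.of_bound hm.aestronglyMeasurable 1 (.of_forall h1)
  have gi : ∀ (m : Measure ℝ) [IsFiniteMeasure m], Integrable (g 0) m := fun m _ =>
    Integrable.of_bound gc.aestronglyMeasurable 1 (.of_forall hg1)
  have di : ∀ (m : Measure ℝ) [IsFiniteMeasure m], Integrable (fun x => |h x - g 0 x|) m :=
    fun m _ => ((hi m).sub (gi m)).abs
  rw [integral_add_measure (di _) (di _), integral_add_measure (di _) (di _)] at hg
  have eω : ∫ x, |h x - g 0 x| ∂ω = ∫ z, |H z * (h z - g 0 z)| ∂(gaussianReal 0 1) := by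
    rw [hω, integral_withDensity_eq_integral_toReal_smul hHm (.of_forall fun _ => by simp)]
    refine integral_congr_ae (.of_forall fun z => ?_)
    simp [abs_mul]
  have Hh : Integrable (fun z => H z * h z) (gaussianReal 0 1) :=
    hHi.mul_bdd (c := 1) hm.aestronglyMeasurable (.of_forall h1)
  have Hg : Integrable (fun z => H z * g 0 z) (gaussianReal 0 1) :=
    hHi.mul_bdd (c := 1) gc.aestronglyMeasurable (.of_forall hg1)
  have d1 := abs_integral_le_integral_abs (μ := σ) (f := fun x => h x - g 0 x)
  have d2 := abs_integral_le_integral_abs (μ := gaussianReal 0 1) (f := fun x => h x - g 0 x)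
  have d3 := abs_integral_le_integral_abs (μ := gaussianReal 0 1)
    (f := fun x => H x * (h x - g 0 x))
  have e3 : ∫ x, H x * (h x - g 0 x) ∂(gaussianReal 0 1) =
      ∫ x, H x * h x ∂(gaussianReal 0 1) - ∫ x, H x * g 0 x ∂(gaussianReal 0 1) := by
    rw [← integral_sub Hh Hg]
    simp only [mul_sub]
  rw [integral_sub (hi _) (gi _)] at d1 d2
  rw [e3] at d3
  rw [← eω] at d3
  have n1 : 0 ≤ ∫ x, |h x - g 0 x| ∂σ := integral_nonneg fun _ => abs_nonneg _
  have n2 : 0 ≤ ∫ x, |h x - g 0 x| ∂(gaussianReal 0 1) := integral_nonneg fun _ => abs_nonneg _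
  have n3 : 0 ≤ ∫ x, |h x - g 0 x| ∂ω := integral_nonneg fun _ => abs_nonneg _
  set A := ∫ x, h x ∂σ - ∫ x, g 0 x ∂σ with hA
  set B := ∫ x, h x ∂(gaussianReal 0 1) - ∫ x, g 0 x ∂(gaussianReal 0 1) with hB
  set E := ∫ x, H x * h x ∂(gaussianReal 0 1) - ∫ x, H x * g 0 x ∂(gaussianReal 0 1) with hE
  have edec : expansionError σ t h = expansionError σ t (g 0) + (A - B - t * E) := by
    rw [expansionError, expansionError, hA, hB, hE]
    ring
  have hABE : |A - B - t * E| ≤ |A| + |B| + |t| * |E| := by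
    rw [← abs_mul]
    exact (abs_sub _ _).trans (add_le_add_left (abs_sub _ _) _)
  rw [le_div_iff₀ (by positivity)] at hg
  have := abs_add_le (expansionError σ t (g 0)) (A - B - t * E)
  have := hK g hg1
  rw [edec]
  have ht := abs_nonneg t
  nlinarith [mul_le_mul_of_nonneg_left d3 ht, mul_nonneg ht n1, mul_nonneg ht n2]

end Approximation

section Law

lemma act_opT_map_pow_apply (μ : Measure ℝ) [IsProbabilityMeasure μ] (c : ℝ) (g : SmoothJet)
    (n : ℕ) (x : ℝ) :
    (act (opT (μ.map (c * ·)) ^ n) g) 0 x =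
      ∫ ω, g 0 (x + c * ∑ i, ω i) ∂(Measure.pi fun _ : Fin n => μ) := by
  induction n generalizing x with
  | zero =>
    simp
  | succ n ih =>
    rw [pow_succ', map_mul, Module.End.mul_apply, act_opT_map_apply]
    simp only [ih]
    have hp := (measurePreserving_piFinSuccAbove (fun _ : Fin (n + 1) => μ) 0)
    have hi : Integrable (fun q : ℝ × (Fin n → ℝ) => g 0 (x + c * q.1 + c * ∑ i, q.2 i))
        (μ.prod (Measure.pi fun _ : Fin n => μ)) := by
      obtain ⟨C, hC⟩ := jet_exists_bound g 0
      have := jet_continuous g 0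
      exact Integrable.of_bound (by fun_prop) C (.of_forall fun _ => hC _)
    have h1 := integral_prod _ hi
    rw [← hp.integral_comp'] at h1
    simp only at h1
    rw [← h1]
    refine integral_congr_ae (.of_forall fun ω => ?_)
    simp only [MeasurableEquiv.piFinSuccAbove_apply, Fin.sum_univ_succ, mul_add, ← add_assoc]
    rfl

end Law

section Assembly

variable {n : ℕ}

lemma opT_gaussian_step (n : ℕ) :
    opT ((gaussianReal 0 1).map ((√n)⁻¹ * ·)) = opT (gaussianReal 0 (1 / n : NNReal)) := by
  refine opT_congr ?_
  rw [← gaussianReal_map_sqrt_mul (1 / n : NNReal)]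
  simp only [one_div, NNReal.coe_inv, NNReal.coe_natCast, Real.sqrt_inv]

lemma dom_gaussian_step (n : ℕ) :
    Dom (opT (gaussianReal 0 (1 / n : NNReal)) - 1 - (1 / (2 * n) : ℝ) • opD ^ 2) (opD ^ 4)
      ((∫ x, x ^ 4 ∂(gaussianReal 0 1)) / 24 / n ^ 2) := by
  have h := dom_taylor (gaussianReal 0 1) integral_id_gaussianReal integral_sq_gaussian
    integral_cube_gaussian
    ((integrable_eval_gaussian (Polynomial.X ^ 4)).congr (.of_forall fun z => by simp)) (√n)⁻¹
  rw [opT_gaussian_step, zero_mul, zero_div, zero_smul, sub_zero, inv_pow,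
    Real.sq_sqrt (Nat.cast_nonneg n), show (√(n : ℝ))⁻¹ ^ 4 = (((n : ℝ) ^ 2)⁻¹) by
      rw [inv_pow, show √(n : ℝ) ^ 4 = (√(n : ℝ) ^ 2) ^ 2 by ring,
        Real.sq_sqrt (Nat.cast_nonneg n)]] at h
  convert h using 1
  · congr 2
    rw [one_div, mul_inv]
    ring
  · ring

lemma dom_step {μ : Measure ℝ} [IsProbabilityMeasure μ] {γ : ℝ} (hmean : ∫ x, x ∂μ = 0)
    (hvar : ∫ x, x ^ 2 ∂μ = 1) (hthird : ∫ x, x ^ 3 ∂μ = γ)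
    (hfourth : Integrable (fun x => x ^ 4) μ) (n : ℕ) :
    Dom (opT (μ.map ((√n)⁻¹ * ·)) - 1 - (1 / (2 * n) : ℝ) • opD ^ 2 -
      (γ / (6 * (n * √n))) • opD ^ 3) (opD ^ 4) ((∫ x, x ^ 4 ∂μ) / 24 / n ^ 2) := by
  have h := dom_taylor μ hmean hvar hthird hfourth (√n)⁻¹
  rw [inv_pow, inv_pow, inv_pow, show √(n : ℝ) ^ 4 = (√(n : ℝ) ^ 2) ^ 2 by ring,
    show √(n : ℝ) ^ 3 = √(n : ℝ) ^ 2 * √n by ring, Real.sq_sqrt (Nat.cast_nonneg n)] at h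
  convert h using 1
  · congr 2
    · congr 1
      rw [one_div, mul_inv]
      ring
    · rw [← div_div]
      ring
  · ring

/-- The expansion for smooth test functions, as a bound for the signed error. -/
lemma abs_expansionError_le_of_bd {μ : Measure ℝ} [IsProbabilityMeasure μ] (hn : 1 ≤ n) {β K : ℝ}
    (hbd : Bd (opT (μ.map ((√n)⁻¹ * ·)) ^ n -
      opT (gaussianReal 0 (1 / n : NNReal)) ^ n * (1 + (n * β) • opD ^ 3)) K)
    (g : SmoothJet) (hg : ∀ x, |g 0 x| ≤ 1) :
    |expansionError ((Measure.pi fun _ : Fin n => μ).map fun ω => (∑ i, ω i) / √n) (n * β) (g 0)|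
      ≤ K := by
  have h := hbd g 1 hg 0
  have hn0 : (n : NNReal) ≠ 0 := by exact_mod_cast (by omega : n ≠ 0)
  rw [opT_gaussianReal_pow, mul_one_div_cancel hn0, map_sub, LinearMap.sub_apply,
    SmoothJet.sub_apply, act_opT_map_pow_apply, mul_add, mul_one, mul_smul_comm, map_add, map_smul,
    map_mul, map_pow, act_opT, act_opD, LinearMap.add_apply, LinearMap.smul_apply,
    SmoothJet.add_apply, SmoothJet.smul_apply, Module.End.mul_apply, convOp_apply, convOp_apply,
    mul_one] at h
  have e3 : (derivOp ^ 3) g 0 = g 3 := rfl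
  simp only [e3, zero_add] at h
  rw [integral_gaussian_third_deriv] at h
  rw [expansionError, integral_map (by fun_prop) (jet_continuous g 0).aestronglyMeasurable]
  simp only [div_eq_inv_mul]
  rwa [sub_sub]

end Assembly

end Edgeworth

open Edgeworth

/-- **Continuous two-term Edgeworth expansion.**
If the law `μ` of the i.i.d. summands has mean `0`, variance `1`, third moment `γ`, finite
fourth moment, and has a compactly supported continuous component whose density is bounded
away from `0`, then the two-term Edgeworth expansion holds for all test functions bounded
by `1`, with error rate `C / n` where `C` does not depend on `n`. -/
theorem continuous_two_term_edgeworth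
    (μ : Measure ℝ) (hprob : IsProbabilityMeasure μ) (γ : ℝ)
    (hmean : ∫ x, x ∂μ = 0)
    (hvar : ∫ x, x ^ 2 ∂μ = 1)
    (hthird : ∫ x, x ^ 3 ∂μ = γ)
    (hfourth : Integrable (fun x => x ^ 4) μ)
    (hcomp : ∃ (p a b c : ℝ) (ν : Measure ℝ) (d : ℝ → ℝ≥0∞),
      0 < p ∧ p ≤ 1 ∧ a < b ∧ 0 < c ∧
      IsProbabilityMeasure ν ∧
      ν = volume.withDensity d ∧
      (∀ x ∈ Set.Icc a b, ENNReal.ofReal c ≤ d x) ∧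
      (∀ x ∉ Set.Icc a b, d x = 0) ∧
      ENNReal.ofReal p • ν ≤ μ) :
    ∃ C : ℝ, ∀ n : ℕ, 1 ≤ n →
      ∀ h : ℝ → ℝ, Measurable h → (∀ x, |h x| ≤ 1) →
      |(∫ ω, h ((∑ i, ω i) / Real.sqrt n) ∂(Measure.pi fun _ : Fin n => μ)) -
          (∫ z, h z ∂(gaussianReal 0 1)) -
          γ / (6 * Real.sqrt n) * ∫ z, (z ^ 3 - 3 * z) * h z ∂(gaussianReal 0 1)|
        ≤ C / n := by
  obtain ⟨p, a, b, c, ν, d, hp, -, hab, hc, -, hν, hd, -, hle⟩ := hcomp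
  have hκ := uniformPart_le hν hd hle
  set κ : NNReal := p.toNNReal * c.toNNReal with hκdef
  have hκ0 : (0 : ℝ) < κ :=
    NNReal.coe_pos.2 (mul_pos (Real.toNNReal_pos.2 hp) (Real.toNNReal_pos.2 hc))
  have hlen : 0 < b - a := sub_pos.2 hab
  have m1 : 0 ≤ ∫ x, x ^ 4 ∂μ := integral_nonneg fun x => by positivity
  have m2 : 0 ≤ ∫ x, x ^ 4 ∂(gaussianReal 0 1) := integral_nonneg fun x => by positivity
  set A : ℝ := (∫ x, x ^ 4 ∂μ) / 24 + (∫ x, x ^ 4 ∂(gaussianReal 0 1)) / 24 with hA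
  refine ⟨edgeworthConst A (|γ| / 6) (κ * (b - a)) ((b - a) / 2), fun n hn h hm h1 => ?_⟩
  have hn0 : (0 : ℝ) < n := by exact_mod_cast hn
  obtain ⟨V, S, S₀, R, hT, hR, hV, hS, hS₀, hDV⟩ :=
    exists_component_decomposition hab hκ (Real.sqrt_pos.2 hn0)
  have hβ : |γ / (6 * (n * √n))| ≤ |γ| / 6 / (n * √n) := by
    rw [abs_div, abs_of_pos (show 0 < 6 * (n * √(n : ℝ)) by positivity), div_div]
  have hμr : IsProbabilityMeasure (μ.map ((√(n : ℝ))⁻¹ * ·)) :=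
    Measure.isProbabilityMeasure_map (by fun_prop)
  have hbd := bd_pow_sub (c := A) hn (by positivity) (by positivity) hβ
    ((dom_step hmean hvar hthird hfourth n).mono (by gcongr; linarith))
    ((dom_gaussian_step n).mono (by gcongr; linarith))
    (bd_opT_prob _) (bd_opT_prob _)
    (fun m hm i => bd_opD_pow_mul_gaussian_pow hn hm i)
    (mul_pos hκ0 hlen) (uniformPart_mass_le hab hκ) (half_pos hlen) hT hR hV hS hS₀ hDV
  have hσ : IsProbabilityMeasure
      ((Measure.pi fun _ : Fin n => μ).map fun ω => (∑ i, ω i) / √(n : ℝ)) :=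
    Measure.isProbabilityMeasure_map (by fun_prop)
  have key := abs_expansionError_le_of_smooth _ (abs_expansionError_le_of_bd hn hbd) hm h1
  rw [expansionError, integral_map (by fun_prop) hm.aestronglyMeasurable,
    show n * (γ / (6 * (n * √(n : ℝ)))) = γ / (6 * √n) by field_simp] at key
  exact key
end

section
/- Let n ≥ 1 and let X_1, …, X_n be i.i.d. real random variables with E[X_1] = 0, E[X_1^2] = 1, E[X_1^3] = γ and E[X_1^4] < ∞. Suppose the law of X_1 has a compactly supported continuous component whose density is bounded away from 0. Let W = (X_1 + … + X_n)/√n and let Φ denote the standard normal distribution function. Then there exists a constant C, depending only on the distribution of X_1 and not on n, such that sup_{x∈ℝ} |P(W ≤ x) − Φ(x) − (γ/(6√(2πn)))·∫_{−∞}^x (y^3 − 3y)·e^{−y^2/2} dy| ≤ C/n. -/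
open MeasureTheory ProbabilityTheory
open scoped ENNReal

namespace EdgeworthExpansion

open Filter Topology Complex
open scoped NNReal

/-- The Gaussian density as the Fourier transform of the Gaussian measure of inverse variance. -/
lemma gaussianPDFReal_eq_integral_cexp {v : ℝ≥0} (w s : ℝ) :
    (gaussianPDFReal 0 v (s - w) : ℂ) = (√(2 * Real.pi * v))⁻¹ *
      ∫ t, cexp (t * w * I) * cexp (-(t * s * I)) ∂gaussianReal 0 v⁻¹ := by
  have h := charFun_gaussianReal (μ := 0) (v := v⁻¹) (w - s)
  rw [charFun_apply_real] at h
  have h2 : ∫ t, cexp (t * w * I) * cexp (-(t * s * I)) ∂gaussianReal 0 v⁻¹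
      = ∫ t, cexp ((w - s : ℝ) * t * I) ∂gaussianReal 0 v⁻¹ := by
    congr with t
    rw [← Complex.exp_add]
    push_cast
    ring_nf
  rw [h2, h, gaussianPDFReal]
  push_cast
  congr 2
  ring

lemma norm_cexp_mul_mul_I (t s : ℝ) : ‖cexp (t * s * I)‖ = 1 := by
  rw [← Complex.norm_exp_ofReal_mul_I (t * s)]; push_cast; ring_nf

lemma norm_cexp_neg_mul_mul_I (t s : ℝ) : ‖cexp (-(t * s * I))‖ = 1 := by
  rw [← Complex.norm_exp_ofReal_mul_I (-(t * s))]; push_cast; ring_nf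

lemma norm_integral_cexp_neg_le {x y t : ℝ} (ht : t ≠ 0) :
    ‖∫ s in y..x, cexp (-(t * s * I))‖ ≤ 2 / |t| := by
  have hc : -(t * I) ≠ 0 := by simp [ht]
  have h : ∀ s : ℝ, cexp (-(t * s * I)) = cexp (-(t * I) * s) := fun s => by ring_nf
  simp_rw [h]
  rw [integral_exp_mul_complex hc, norm_div, norm_neg, norm_mul, norm_I, mul_one, norm_real,
    Real.norm_eq_abs]
  gcongr
  refine (norm_sub_le _ _).trans ?_
  rw [← h, ← h, norm_cexp_neg_mul_mul_I, norm_cexp_neg_mul_mul_I]; norm_num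

/-- The distribution function of the measure with density `h` relative to `m`, convolved with a
centred Gaussian of variance `v`. -/
noncomputable def smoothedCDF (m : Measure ℝ) (h : ℝ → ℝ) (v : ℝ≥0) (x : ℝ) : ℝ :=
  ∫ z, (∫ w in Set.Iic (x - z), h w ∂m) ∂gaussianReal 0 v

section Smoothing

variable {m : Measure ℝ} {h : ℝ → ℝ} {v : ℝ≥0}

lemma integrable_prod_indicator [IsFiniteMeasure m] (hh : Integrable h m) (x : ℝ) :
    Integrable (fun p : ℝ × ℝ => (Set.Iic (x - p.1)).indicator h p.2)
      ((gaussianReal 0 v).prod m) := by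
  have h1 : Integrable (fun p : ℝ × ℝ => h p.2) ((gaussianReal 0 v).prod m) := hh.comp_snd _
  have hs : MeasurableSet {p : ℝ × ℝ | p.2 ≤ x - p.1} :=
    measurableSet_le (by fun_prop) (by fun_prop)
  exact h1.indicator hs

lemma smoothedCDF_eq [IsFiniteMeasure m] (hh : Integrable h m) (x : ℝ) :
    smoothedCDF m h v x = ∫ w, h w * (gaussianReal 0 v).real (Set.Iic (x - w)) ∂m := by
  unfold smoothedCDF
  simp_rw [← integral_indicator (measurableSet_Iic)]
  rw [integral_integral_swap (integrable_prod_indicator hh x)]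
  congr with w
  have : ∀ z, (Set.Iic (x - z)).indicator h w = (Set.Iic (x - w)).indicator (fun _ => h w) z := by
    intro z
    simp only [Set.indicator, Set.mem_Iic]
    congr 1
    simp only [eq_iff_iff]
    constructor <;> intro <;> linarith
  simp_rw [this]
  rw [integral_indicator measurableSet_Iic, setIntegral_const, smul_eq_mul, mul_comm]

lemma gaussianReal_real_Iic_sub (hv : v ≠ 0) {x y : ℝ} (w : ℝ) :
    (gaussianReal 0 v).real (Set.Iic (x - w)) - (gaussianReal 0 v).real (Set.Iic (y - w))
      = ∫ s in y..x, gaussianPDFReal 0 v (s - w) := by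
  have h1 : ∀ a, (gaussianReal 0 v).real (Set.Iic a) = ∫ s in Set.Iic a, gaussianPDFReal 0 v s := by
    intro a
    rw [measureReal_def, gaussianReal_apply_eq_integral _ hv, ENNReal.toReal_ofReal]
    exact integral_nonneg fun _ => gaussianPDFReal_nonneg _ _ _
  rw [h1, h1, intervalIntegral.integral_Iic_sub_Iic, intervalIntegral.integral_comp_sub_right]
  · exact (integrable_gaussianPDFReal _ _).integrableOn
  · exact (integrable_gaussianPDFReal _ _).integrableOn

lemma integrable_kernel_prod (N : Measure ℝ) [IsFiniteMeasure N] (hh : Integrable h m) (x y : ℝ) :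
    Integrable (fun p : ℝ × ℝ => (∫ s in y..x, cexp (-(p.2 * s * I))) *
      (h p.1 * cexp (p.2 * p.1 * I))) (m.prod N) := by
  have hK : Continuous fun t : ℝ => ∫ s in y..x, cexp (-(t * s * I)) := by
    apply intervalIntegral.continuous_parametric_intervalIntegral_of_continuous'
    fun_prop
  have hKb : ∀ t : ℝ, ‖∫ s in y..x, cexp (-(t * s * I))‖ ≤ |x - y| := fun t => by
    have := intervalIntegral.norm_integral_le_of_norm_le_const (a := y) (b := x) (C := 1)
      (f := fun s : ℝ => cexp (-(t * s * I))) (fun s _ => (norm_cexp_neg_mul_mul_I t s).le)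
    simpa using this
  have h1 : Integrable (fun p : ℝ × ℝ => ‖h p.1‖ * |x - y|) (m.prod N) :=
    (hh.norm.comp_fst N).mul_const _
  refine h1.mono' ?_ ?_
  · have : AEStronglyMeasurable (fun p : ℝ × ℝ => (h p.1 : ℂ)) (m.prod N) :=
      (hh.ofReal (𝕜 := ℂ)).comp_fst N |>.aestronglyMeasurable
    exact (hK.comp continuous_snd).aestronglyMeasurable.mul
      (this.mul (Continuous.aestronglyMeasurable (by fun_prop)))
  · filter_upwards with p
    simp only [norm_mul, norm_cexp_mul_mul_I, norm_real, mul_one]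
    rw [mul_comm]
    gcongr
    exact hKb _

lemma integrable_kernel_mul [IsFiniteMeasure m] (N : Measure ℝ) [IsFiniteMeasure N]
    (hh : Integrable h m) (x y : ℝ) :
    Integrable (fun t : ℝ => (∫ s in y..x, cexp (-(t * s * I))) *
      (∫ w, h w * cexp (t * w * I) ∂m)) N := by
  have := (integrable_kernel_prod N hh x y).integral_prod_right
  simpa only [integral_const_mul] using this

lemma smoothedCDF_sub [IsFiniteMeasure m] (hv : v ≠ 0) (hh : Integrable h m) (x y : ℝ) :
    ((smoothedCDF m h v x - smoothedCDF m h v y : ℝ) : ℂ) = (√(2 * Real.pi * v))⁻¹ *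
      ∫ t, (∫ s in y..x, cexp (-(t * s * I))) * (∫ w, h w * cexp (t * w * I) ∂m)
        ∂gaussianReal 0 v⁻¹ := by
  set N := gaussianReal 0 v⁻¹
  set K : ℝ → ℂ := fun t => ∫ s in y..x, cexp (-(t * s * I)) with hK
  have hint : ∀ a, Integrable (fun w => h w * (gaussianReal 0 v).real (Set.Iic (a - w))) m := by
    intro a
    refine hh.mul_bdd (c := 1) ?_ ?_
    · have : Monotone fun b => (gaussianReal 0 v).real (Set.Iic b) := fun b c hbc =>
        measureReal_mono (Set.Iic_subset_Iic.2 hbc)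
      exact (this.measurable.comp (by fun_prop : Measurable fun w => a - w)).aestronglyMeasurable
    · filter_upwards with w
      rw [Real.norm_eq_abs, abs_of_nonneg measureReal_nonneg]
      exact measureReal_le_one
  rw [smoothedCDF_eq hh, smoothedCDF_eq hh, ← integral_sub (hint x) (hint y)]
  simp_rw [← mul_sub, gaussianReal_real_Iic_sub hv]
  rw [← integral_complex_ofReal]
  have hinner : ∀ w : ℝ, ((h w * ∫ s in y..x, gaussianPDFReal 0 v (s - w) : ℝ) : ℂ)
      = (√(2 * Real.pi * v))⁻¹ * ∫ t, K t * (h w * cexp (t * w * I)) ∂N := by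
    intro w
    push_cast
    rw [← intervalIntegral.integral_ofReal]
    simp_rw [gaussianPDFReal_eq_integral_cexp]
    rw [intervalIntegral.integral_const_mul, intervalIntegral_integral_swap]
    · simp_rw [intervalIntegral.integral_const_mul]
      have : ∀ t, K t * (h w * cexp (t * w * I)) = h w * (cexp (t * w * I) * K t) :=
        fun t => by ring
      simp_rw [this, integral_const_mul]
      push_cast
      ring
    · have : IsFiniteMeasure (volume.restrict (Set.uIoc y x)) := ⟨by simp [Set.uIoc]⟩
      refine Integrable.mono' (g := fun _ => 1) (integrable_const _)
        (Continuous.aestronglyMeasurable (by fun_prop)) ?_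
      filter_upwards with p
      simp [norm_cexp_mul_mul_I, norm_cexp_neg_mul_mul_I, Function.uncurry]
  simp_rw [hinner]
  rw [integral_const_mul, integral_integral_swap]
  · congr 2 with t
    rw [integral_const_mul]
  · exact integrable_kernel_prod N hh x y

lemma norm_setIntegral_Iic_le (hh : Integrable h m) (x : ℝ) :
    ‖∫ w in Set.Iic x, h w ∂m‖ ≤ ∫ w, ‖h w‖ ∂m :=
  (norm_integral_le_integral_norm _).trans
    (setIntegral_le_integral hh.norm (ae_of_all _ fun _ => norm_nonneg _))

lemma tendsto_setIntegral_Iic_atBot (hh : Integrable h m) :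
    Tendsto (fun x => ∫ w in Set.Iic x, h w ∂m) atBot (𝓝 0) := by
  simp_rw [← integral_indicator (measurableSet_Iic)]
  rw [show (0 : ℝ) = ∫ _, 0 ∂m by simp]
  refine tendsto_integral_filter_of_dominated_convergence (fun w => ‖h w‖)
    (Eventually.of_forall fun x => hh.aestronglyMeasurable.indicator measurableSet_Iic)
    (Eventually.of_forall fun x => ae_of_all _ fun w => norm_indicator_le_norm_self _ _)
    hh.norm (ae_of_all _ fun w => ?_)
  refine tendsto_const_nhds.congr' ?_
  filter_upwards [eventually_lt_atBot w] with x hx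
  simp [hx]

lemma measurable_setIntegral_Iic [IsFiniteMeasure m] (hh : Integrable h m) :
    StronglyMeasurable fun x => ∫ w in Set.Iic x, h w ∂m := by
  obtain ⟨g, hg, hgh⟩ := hh.aestronglyMeasurable
  have : ∀ x, ∫ w in Set.Iic x, h w ∂m = ∫ w, (Set.Iic x).indicator g w ∂m := fun x => by
    rw [integral_indicator measurableSet_Iic]
    exact integral_congr_ae (ae_restrict_of_ae hgh)
  simp_rw [this]
  have hs : MeasurableSet {p : ℝ × ℝ | p.2 ≤ p.1} :=
    measurableSet_le (by fun_prop) (by fun_prop)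
  have h2 : StronglyMeasurable (fun p : ℝ × ℝ => (Set.Iic p.1).indicator g p.2) :=
    (hg.comp_measurable measurable_snd).indicator hs
  exact h2.integral_prod_right

lemma tendsto_smoothedCDF_atBot [IsFiniteMeasure m] (hh : Integrable h m) :
    Tendsto (smoothedCDF m h v) atBot (𝓝 0) := by
  unfold smoothedCDF
  suffices Tendsto (fun x => ∫ z, (∫ w in Set.Iic (x - z), h w ∂m) ∂gaussianReal 0 v) atBot
      (𝓝 (∫ _, (0 : ℝ) ∂gaussianReal 0 v)) by rwa [integral_zero] at this
  refine tendsto_integral_filter_of_dominated_convergence (fun _ => ∫ w, ‖h w‖ ∂m)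
    (Eventually.of_forall fun x => ((measurable_setIntegral_Iic (m := m) hh).comp_measurable
      (by fun_prop : Measurable fun z => x - z)).aestronglyMeasurable)
    (Eventually.of_forall fun x => ae_of_all _ fun w => norm_setIntegral_Iic_le hh _)
    (integrable_const _) (ae_of_all _ fun z => ?_)
  refine (tendsto_setIntegral_Iic_atBot hh).comp ?_
  exact tendsto_atBot_add_const_right _ _ tendsto_id

end Smoothing

/-- Smoothing inequality: closeness of Fourier transforms gives closeness of smoothed distribution
functions. -/
lemma abs_smoothedCDF_sub_le {m₁ m₂ : Measure ℝ} [IsFiniteMeasure m₁] [IsFiniteMeasure m₂]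
    {h₁ h₂ : ℝ → ℝ} {v : ℝ≥0} (hv : v ≠ 0) (hh₁ : Integrable h₁ m₁) (hh₂ : Integrable h₂ m₂)
    {B : ℝ → ℝ} (hB : Integrable B (gaussianReal 0 v⁻¹))
    (hBD : ∀ t : ℝ, t ≠ 0 → ‖∫ w, h₁ w * cexp (t * w * I) ∂m₁ - ∫ w, h₂ w * cexp (t * w * I) ∂m₂‖
      ≤ |t| * B t) (x : ℝ) :
    |smoothedCDF m₁ h₁ v x - smoothedCDF m₂ h₂ v x|
      ≤ (√(2 * Real.pi * v))⁻¹ * (2 * ∫ t, B t ∂gaussianReal 0 v⁻¹) := by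
  have hv' : v⁻¹ ≠ 0 := inv_ne_zero hv
  have key : ∀ y, |(smoothedCDF m₁ h₁ v x - smoothedCDF m₁ h₁ v y)
      - (smoothedCDF m₂ h₂ v x - smoothedCDF m₂ h₂ v y)|
      ≤ (√(2 * Real.pi * v))⁻¹ * (2 * ∫ t, B t ∂gaussianReal 0 v⁻¹) := by
    intro y
    rw [← Real.norm_eq_abs, ← Complex.norm_real, Complex.ofReal_sub, smoothedCDF_sub hv hh₁,
      smoothedCDF_sub hv hh₂, ← mul_sub, ← integral_sub, norm_mul, norm_real,
      Real.norm_of_nonneg (by positivity), ← integral_const_mul]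
    · gcongr
      refine norm_integral_le_of_norm_le (hB.const_mul _) ?_
      have : ∀ᵐ t ∂gaussianReal 0 v⁻¹, t ≠ 0 := by
        have := nullSingletonClass_gaussianReal (μ := 0) hv'
        exact (measure_singleton (0 : ℝ) : gaussianReal 0 v⁻¹ {0} = 0) |> compl_mem_ae_iff.2
      filter_upwards [this] with t ht
      rw [← mul_sub, norm_mul]
      calc _ ≤ (2 / |t|) * (|t| * B t) := by
            gcongr
            · exact norm_integral_cexp_neg_le ht
            · exact hBD t ht
        _ = _ := by field_simp
    · exact integrable_kernel_mul _ hh₁ x y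
    · exact integrable_kernel_mul _ hh₂ x y
  have hlim := ((tendsto_smoothedCDF_atBot (v := v) hh₁).const_sub (smoothedCDF m₁ h₁ v x)).sub
    ((tendsto_smoothedCDF_atBot (v := v) hh₂).const_sub (smoothedCDF m₂ h₂ v x)) |>.abs
  rw [sub_zero, sub_zero] at hlim
  exact le_of_tendsto hlim (Eventually.of_forall key)

section Desmoothing

variable {N : Measure ℝ} [IsProbabilityMeasure N] {r η : ℝ}

lemma le_of_le_on_Icc_of_integral_le (hN : 3 / 4 ≤ N.real (Set.Icc (-r) r)) {K : ℝ → ℝ}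
    (hK : Integrable K N) {A M : ℝ} (hM : 0 ≤ M) (hη : 0 ≤ η) (hKM : ∀ z, -M ≤ K z)
    (hKA : ∀ z ∈ Set.Icc (-r) r, A ≤ K z) (hint : ∫ z, K z ∂N ≤ η) :
    A ≤ 4 / 3 * η + M / 3 := by
  have h1 : ∫ z, ((Set.Icc (-r) r).indicator (fun _ => A + M) z - M) ∂N ≤ ∫ z, K z ∂N := by
    refine integral_mono (((integrable_const _).indicator measurableSet_Icc).sub
      (integrable_const _)) hK fun z => ?_
    by_cases hz : z ∈ Set.Icc (-r) r
    · simp only [Set.indicator_of_mem hz]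
      linarith [hKA z hz]
    · simp only [Set.indicator_of_notMem hz]
      linarith [hKM z]
  rw [integral_sub ((integrable_const _).indicator measurableSet_Icc) (integrable_const _),
    integral_indicator measurableSet_Icc, setIntegral_const] at h1
  simp only [smul_eq_mul, integral_const, probReal_univ, one_mul] at h1
  by_cases hA : 0 ≤ A + M
  · nlinarith
  · linarith

/-- A monotone function is uniformly close to a Lipschitz function as soon as this holds after
convolution with a concentrated probability measure. -/
lemma abs_sub_le_of_abs_integral_le (hr : 0 ≤ r) (hN : 3 / 4 ≤ N.real (Set.Icc (-r) r))
    {F G : ℝ → ℝ} (hF : Monotone F) {L : ℝ} (hG : ∀ x y, |G x - G y| ≤ L * |x - y|)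
    {M₀ : ℝ} (hb : ∀ x, |F x - G x| ≤ M₀)
    (hη : ∀ x, |∫ z, (F (x - z) - G (x - z)) ∂N| ≤ η) (x : ℝ) :
    |F x - G x| ≤ 3 * r * L + 2 * η := by
  have hL : 0 ≤ L := by simpa using (abs_nonneg _).trans (hG 1 0)
  have hη0 : 0 ≤ η := (abs_nonneg _).trans (hη 0)
  have hbdd : BddAbove (Set.range fun x => |F x - G x|) := ⟨M₀, by rintro _ ⟨x, rfl⟩; exact hb x⟩
  set M := ⨆ x, |F x - G x|
  have hM : ∀ x, |F x - G x| ≤ M := fun x => le_ciSup hbdd x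
  have hM0 : 0 ≤ M := (abs_nonneg _).trans (hM 0)
  have hGc : Continuous G := by
    refine (LipschitzWith.of_dist_le_mul (K := L.toNNReal) fun x y => ?_).continuous
    rw [Real.dist_eq, Real.dist_eq, Real.coe_toNNReal _ hL]
    exact hG x y
  have hint : ∀ x, Integrable (fun z => F (x - z) - G (x - z)) N := fun x => by
    refine Integrable.of_bound (C := M) ?_ (ae_of_all _ fun z => hM (x - z))
    have := hF.measurable
    have := hGc.measurable
    exact (by fun_prop : Measurable fun z => F (x - z) - G (x - z)).aestronglyMeasurable
  have hub : ∀ x, |F x - G x| ≤ 2 * r * L + 4 / 3 * η + M / 3 := by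
    intro x
    refine abs_le.2 ⟨?_, ?_⟩
    · have := le_of_le_on_Icc_of_integral_le hN (hint (x - r)).neg (A := -(F x - G x) - 2 * r * L)
        hM0 hη0 (fun z => neg_le_neg (abs_le.1 (hM (x - r - z))).2) (fun z hz => ?_)
        (by rw [integral_neg']; exact neg_le.1 (abs_le.1 (hη _)).1)
      · linarith
      · have h1 := hF (show x - r - z ≤ x by linarith [hz.1])
        have h2 := (abs_le.1 (hG (x - r - z) x)).1
        have h3 : |x - r - z - x| ≤ 2 * r := abs_le.2 ⟨by linarith [hz.2], by linarith [hz.1]⟩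
        have h4 := mul_le_mul_of_nonneg_left h3 hL
        simp only [Pi.neg_apply]
        linarith
    · have := le_of_le_on_Icc_of_integral_le hN (hint (x + r)) (A := (F x - G x) - 2 * r * L)
        hM0 hη0 (fun z => (abs_le.1 (hM (x + r - z))).1) (fun z hz => ?_) (abs_le.1 (hη _)).2
      · linarith
      · have h1 := hF (show x ≤ x + r - z by linarith [hz.2])
        have h2 := (abs_le.1 (hG (x + r - z) x)).2
        have h3 : |x + r - z - x| ≤ 2 * r := abs_le.2 ⟨by linarith [hz.2], by linarith [hz.1]⟩
        have h4 := mul_le_mul_of_nonneg_left h3 hL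
        linarith
  have hMle : M ≤ 2 * r * L + 4 / 3 * η + M / 3 := ciSup_le hub
  linarith [hM x]

end Desmoothing

lemma three_fourths_le_gaussianReal_Icc (v : ℝ≥0) (hv : v ≠ 0) :
    3 / 4 ≤ (gaussianReal 0 v).real (Set.Icc (-(2 * √v)) (2 * √v)) := by
  have hvp : 0 < √(v : ℝ) := by positivity
  have h := meas_ge_le_variance_div_sq (μ := gaussianReal 0 v)
    (memLp_id_gaussianReal 2) (show 0 < 2 * √(v : ℝ) by positivity)
  rw [variance_id_gaussianReal] at h
  simp only [id_eq, integral_id_gaussianReal, sub_zero] at h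
  rw [mul_pow, Real.sq_sqrt v.coe_nonneg] at h
  have h4 : (v : ℝ) / (2 ^ 2 * v) = 1 / 4 := by
    have : (v : ℝ) ≠ 0 := by exact_mod_cast hv
    field_simp; norm_num
  rw [h4] at h
  have h5 : (gaussianReal 0 v).real {ω | 2 * √(v : ℝ) ≤ |ω|} ≤ 1 / 4 :=
    ENNReal.toReal_le_of_le_ofReal (by norm_num) h
  have h6 : (Set.Icc (-(2 * √(v : ℝ))) (2 * √v))ᶜ ⊆ {ω | 2 * √(v : ℝ) ≤ |ω|} := by
    intro ω hω
    by_contra hc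
    exact hω (abs_le.1 (not_le.1 hc).le)
  have h7 := measureReal_mono (μ := gaussianReal 0 v) h6
  rw [probReal_compl_eq_one_sub measurableSet_Icc] at h7
  linarith

section CharFun

lemma norm_cexp_mul_I_sub_one_sub_le (u : ℝ) : ‖cexp (u * I) - 1 - u * I‖ ≤ 3 * u ^ 2 := by
  have hn : ‖(u : ℂ) * I‖ = |u| := by simp
  by_cases hu : |u| ≤ 1
  · have := Complex.norm_exp_sub_one_sub_id_le (hn.trans_le hu)
    rw [hn, sq_abs] at this
    nlinarith [sq_nonneg u]
  · push Not at hu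
    calc ‖cexp (u * I) - 1 - u * I‖ ≤ ‖cexp (u * I)‖ + ‖(1 : ℂ)‖ + ‖(u : ℂ) * I‖ :=
          (norm_sub_le _ _).trans (by gcongr; exact norm_sub_le _ _)
      _ = 2 + |u| := by rw [hn, norm_exp_ofReal_mul_I, norm_one]; norm_num
      _ ≤ 3 * |u| ^ 2 := by nlinarith
      _ = 3 * u ^ 2 := by rw [sq_abs]

lemma norm_pow_sub_pow_le {a b : ℂ} {M : ℝ} (ha : ‖a‖ ≤ M) (hb : ‖b‖ ≤ M) (n : ℕ) :
    ‖a ^ n - b ^ n‖ ≤ n * ‖a - b‖ * M ^ (n - 1) := by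
  have hM : 0 ≤ M := (norm_nonneg _).trans ha
  rw [← (Commute.all a b).geom_sum₂_mul, norm_mul]
  have : ‖∑ i ∈ Finset.range n, a ^ i * b ^ (n - 1 - i)‖ ≤ n * M ^ (n - 1) := by
    refine (norm_sum_le_of_le _ (f := fun i => a ^ i * b ^ (n - 1 - i))
      (n := fun _ => M ^ (n - 1)) fun i hi => ?_).trans_eq (by simp)
    rw [norm_mul, norm_pow, norm_pow]
    calc ‖a‖ ^ i * ‖b‖ ^ (n - 1 - i) ≤ M ^ i * M ^ (n - 1 - i) := by gcongr
      _ = M ^ (n - 1) := by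
        rw [← pow_add]
        congr 1
        have := Finset.mem_range.1 hi
        omega
  calc _ ≤ n * M ^ (n - 1) * ‖a - b‖ := by gcongr
    _ = _ := by ring

lemma exists_abs_sinc_le {δ : ℝ} (hδ : 0 < δ) :
    ∃ ρ < 1, 0 ≤ ρ ∧ ∀ u, δ ≤ |u| → |Real.sinc u| ≤ ρ := by
  obtain ⟨x, hx, hmax⟩ := isCompact_Icc.exists_isMaxOn (s := Set.Icc δ (max δ 2))
    (f := fun u => |Real.sinc u|) ⟨δ, by simp⟩ (by fun_prop)
  have hx0 : x ≠ 0 := (hδ.trans_le hx.1).ne'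
  refine ⟨max |Real.sinc x| (1 / 2), max_lt ?_ (by norm_num),
    le_max_of_le_right (by norm_num), fun u hu => ?_⟩
  · rw [Real.sinc_of_ne_zero hx0, abs_div, div_lt_one (abs_pos.2 hx0)]
    exact Real.abs_sin_lt_abs hx0
  · have hu0 : u ≠ 0 := abs_pos.1 (hδ.trans_le hu)
    have habs : |Real.sinc u| = |Real.sinc (|u|)| := by
      rcases abs_choice u with h | h <;> rw [h]
      rw [Real.sinc_neg]
    by_cases h2 : |u| ≤ 2
    · rw [habs]
      exact le_max_of_le_left (hmax ⟨hu, le_max_of_le_right h2⟩)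
    · push Not at h2
      refine le_max_of_le_right ?_
      rw [Real.sinc_of_ne_zero hu0, abs_div]
      exact div_le_div₀ zero_le_one (Real.abs_sin_le_one u) (by norm_num) h2.le

lemma norm_integral_cexp_mul_I {a b s : ℝ} (hab : a < b) (hs : s ≠ 0) :
    ‖∫ x in a..b, cexp (s * x * I)‖ = (b - a) * |Real.sinc (s * (b - a) / 2)| := by
  have hba : 0 < b - a := sub_pos.2 hab
  have hc : (s : ℂ) * I ≠ 0 := by simp [hs]
  have h1 : ∀ x : ℝ, cexp (s * x * I) = cexp (s * I * x) := fun x => by ring_nf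
  have h2 : cexp (s * I * b) - cexp (s * I * a)
      = cexp (s * a * I) * (cexp (I * (s * (b - a) : ℝ)) - 1) := by
    rw [mul_sub, ← Complex.exp_add]; push_cast; ring_nf
  simp_rw [h1]
  rw [integral_exp_mul_complex hc, h2, norm_div, norm_mul, norm_cexp_mul_mul_I,
    norm_exp_I_mul_ofReal_sub_one, norm_mul, norm_mul (s : ℂ), norm_I, norm_real,
    Real.sinc_of_ne_zero (by positivity), Real.norm_eq_abs, Real.norm_eq_abs, Real.norm_eq_abs,
    abs_div, abs_div, abs_mul, abs_of_pos hba, abs_two]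
  field_simp

variable {μ : Measure ℝ} [IsProbabilityMeasure μ]

lemma norm_charFun_le_of_smul_restrict_le {q : ℝ≥0} {a b : ℝ} (hab : a < b)
    (hq : (q : ℝ≥0∞) • volume.restrict (Set.Icc a b) ≤ μ) {s : ℝ} (hs : s ≠ 0) :
    ‖charFun μ s‖ ≤ 1 - q * (b - a) * (1 - |Real.sinc (s * (b - a) / 2)|) := by
  have hba : 0 < b - a := sub_pos.2 hab
  set ν : Measure ℝ := (q : ℝ≥0∞) • volume.restrict (Set.Icc a b)
  have : IsFiniteMeasure ν := isFiniteMeasure_of_le μ hq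
  have hsum : μ - ν + ν = μ := Measure.sub_add_cancel_of_le hq
  have hint : ∀ (κ : Measure ℝ) [IsFiniteMeasure κ],
      Integrable (fun x : ℝ => cexp (s * x * I)) κ := fun κ _ =>
    Integrable.of_bound (C := 1) (Continuous.aestronglyMeasurable (by fun_prop))
      (ae_of_all _ fun x => (norm_cexp_mul_mul_I s x).le)
  have hν : ν.real Set.univ = q * (b - a) := by
    rw [measureReal_def, Measure.smul_apply, Measure.restrict_apply_univ, Real.volume_Icc,
      smul_eq_mul, ENNReal.toReal_mul, ENNReal.toReal_ofReal hba.le, ENNReal.coe_toReal]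
  have hmass : (μ - ν).real Set.univ = 1 - q * (b - a) := by
    have h := measureReal_add_apply (μ₁ := μ - ν) (μ₂ := ν) (s := Set.univ)
    rw [hsum, probReal_univ, hν] at h
    linarith
  have hadd : charFun μ s = charFun (μ - ν) s + charFun ν s := by
    conv_lhs => rw [← hsum]
    simp only [charFun_apply_real]
    exact integral_add_measure (hint _) (hint _)
  have h1 : ‖charFun ν s‖ = q * ((b - a) * |Real.sinc (s * (b - a) / 2)|) := by
    rw [← norm_integral_cexp_mul_I hab hs, charFun_apply_real, integral_smul_measure,
      intervalIntegral.integral_of_le hab.le, integral_Icc_eq_integral_Ioc, norm_smul]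
    simp
  rw [hadd]
  refine (norm_add_le _ _).trans ?_
  rw [h1]
  have := (norm_charFun_le (μ := μ - ν) s).trans_eq hmass
  linarith

/-- Cramér's condition for laws with an absolutely continuous component. -/
lemma exists_norm_charFun_le {q : ℝ≥0} (hq0 : 0 < q) {a b : ℝ} (hab : a < b)
    (hq : (q : ℝ≥0∞) • volume.restrict (Set.Icc a b) ≤ μ) {δ : ℝ} (hδ : 0 < δ) :
    ∃ ρ < 1, 0 ≤ ρ ∧ ∀ s, δ ≤ |s| → ‖charFun μ s‖ ≤ ρ := by
  have hba : 0 < b - a := sub_pos.2 hab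
  obtain ⟨σ, hσ1, hσ0, hσ⟩ := exists_abs_sinc_le (show 0 < δ * (b - a) / 2 by positivity)
  have hpos : 0 < q * (b - a) * (1 - σ) :=
    mul_pos (mul_pos (by exact_mod_cast hq0) hba) (sub_pos.2 hσ1)
  have hbd : ∀ s, δ ≤ |s| → ‖charFun μ s‖ ≤ 1 - q * (b - a) * (1 - σ) := fun s hs => by
    refine (norm_charFun_le_of_smul_restrict_le hab hq (abs_pos.1 (hδ.trans_le hs))).trans ?_
    gcongr
    refine hσ _ ?_
    rw [abs_div, abs_mul, abs_of_pos hba, abs_two]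
    gcongr
  refine ⟨1 - q * (b - a) * (1 - σ), by linarith, ?_, hbd⟩
  exact (norm_nonneg _).trans (hbd δ (le_abs_self δ))

/-- Third order expansion of the characteristic function at the origin. -/
lemma exists_norm_charFun_sub_le (hmean : ∫ x, x ∂μ = 0) (hvar : ∫ x, x ^ 2 ∂μ = 1)
    (hfourth : Integrable (fun x => x ^ 4) μ) :
    ∃ δ > 0, ∃ K, 0 ≤ K ∧ ∀ s : ℝ, |s| ≤ δ →
      ‖charFun μ s - (1 - s ^ 2 / 2 + (∫ x, x ^ 3 ∂μ : ℝ) / 6 * (s * I) ^ 3)‖ ≤ K * s ^ 4 := by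
  have hmem : MemLp id (4 : ℕ) μ := by
    rw [← integrable_norm_rpow_iff aestronglyMeasurable_id (by simp) (by simp)]
    simpa [Even.pow_abs (show Even 4 by decide)] using hfourth
  have h := (taylor_isLittleO_univ (x₀ := 0) (contDiff_charFun hmem)).bound one_pos
  obtain ⟨δ, hδ, hball⟩ := Metric.eventually_nhds_iff.1 h
  refine ⟨δ / 2, by positivity, 1 + |∫ x, x ^ 4 ∂μ| / 24, by positivity, fun s hs => ?_⟩
  have h1 := hball (show dist s 0 < δ by rw [Real.dist_eq, sub_zero]; linarith)
  rw [taylorWithinEval_charFun_zero hmem] at h1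
  simp only [Finset.sum_range_succ, Finset.range_one, Finset.sum_singleton, Nat.factorial,
    pow_one, hmean, hvar] at h1
  have hI : (I : ℂ) ^ 4 = 1 := I_pow_four
  have h2 : charFun μ s - (1 - s ^ 2 / 2 + (∫ x, x ^ 3 ∂μ : ℝ) / 6 * (s * I) ^ 3)
      = (charFun μ s - (1 - s ^ 2 / 2 + (∫ x, x ^ 3 ∂μ : ℝ) / 6 * (s * I) ^ 3
        + (((∫ x, x ^ 4 ∂μ) / 24 * s ^ 4 : ℝ) : ℂ)))
        + (((∫ x, x ^ 4 ∂μ) / 24 * s ^ 4 : ℝ) : ℂ) := by ring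
  rw [h2]
  refine (norm_add_le _ _).trans ?_
  rw [norm_real, Real.norm_eq_abs, abs_mul, abs_div, abs_of_pos (show (0 : ℝ) < 24 by norm_num),
    abs_of_nonneg (show 0 ≤ s ^ 4 by positivity), add_mul]
  gcongr
  rw [Real.norm_eq_abs, sub_zero, abs_of_nonneg (show 0 ≤ s ^ 4 by positivity)] at h1
  refine le_trans (le_of_eq ?_) h1
  congr 2
  simp [mul_pow]
  ring

end CharFun

section Expansion

variable {μ : Measure ℝ} [IsProbabilityMeasure μ]

lemma exists_norm_charFun_sub_cexp_le (hmean : ∫ x, x ∂μ = 0) (hvar : ∫ x, x ^ 2 ∂μ = 1)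
    (hfourth : Integrable (fun x => x ^ 4) μ) :
    ∃ δ > 0, δ ≤ 1 ∧ ∃ K, 0 ≤ K ∧ ∀ s : ℝ, |s| ≤ δ → ‖charFun μ s‖ ≤ Real.exp (-s ^ 2 / 4) ∧
      ‖charFun μ s - cexp (-s ^ 2 / 2 + (∫ x, x ^ 3 ∂μ : ℝ) / 6 * (s * I) ^ 3)‖ ≤ K * s ^ 4 := by
  obtain ⟨δ, hδ, K, hK, h⟩ := exists_norm_charFun_sub_le hmean hvar hfourth
  set γ := ∫ x, x ^ 3 ∂μ
  set c := |γ / 6|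
  have hc : 0 ≤ c := abs_nonneg _
  refine ⟨min δ (1 / (4 * (c + K + 1))), by positivity, ?_, K + 1, by positivity, fun s hs => ?_⟩
  · refine (min_le_right _ _).trans ?_
    rw [div_le_one (by positivity)]
    linarith
  obtain ⟨hs1, hs2⟩ := le_min_iff.1 hs
  rw [le_div_iff₀ (by positivity)] at hs2
  have hs0 := abs_nonneg s
  have hsm : (c + K) * |s| ≤ 1 / 4 := by nlinarith
  have hs3 : |s| ≤ 1 := by nlinarith [mul_nonneg hs0 (add_nonneg hc hK)]
  have hsq : s ^ 2 = |s| ^ 2 := (sq_abs s).symm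
  have hs4 : s ^ 4 = |s| ^ 4 := ((by decide : Even 4).pow_abs s).symm
  have hcube : ‖(γ : ℂ) / 6 * (s * I) ^ 3‖ = c * |s| ^ 3 := by
    simp [c, abs_div]
  have hsmall : c * |s| ^ 3 + K * |s| ^ 4 ≤ |s| ^ 2 / 4 := by
    have h1 : |s| ^ 4 ≤ |s| ^ 3 := pow_le_pow_of_le_one hs0 hs3 (by norm_num)
    calc c * |s| ^ 3 + K * |s| ^ 4 ≤ c * |s| ^ 3 + K * |s| ^ 3 := by gcongr
      _ = ((c + K) * |s|) * |s| ^ 2 := by ring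
      _ ≤ 1 / 4 * |s| ^ 2 := by gcongr
      _ = _ := by ring
  have h4 : 0 ≤ K * |s| ^ 4 := by positivity
  have h3 : 0 ≤ c * |s| ^ 3 := by positivity
  have hs2' : |s| ^ 2 ≤ 1 := pow_le_one₀ hs0 hs3
  constructor
  · have hre : ‖(1 : ℂ) - s ^ 2 / 2‖ = 1 - |s| ^ 2 / 2 := by
      rw [← hsq, show (1 : ℂ) - s ^ 2 / 2 = ((1 - s ^ 2 / 2 : ℝ) : ℂ) by push_cast; rfl,
        norm_real, Real.norm_of_nonneg]
      rw [hsq]; linarith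
    calc ‖charFun μ s‖ = ‖(charFun μ s - (1 - s ^ 2 / 2 + γ / 6 * (s * I) ^ 3))
            + (1 - s ^ 2 / 2) + γ / 6 * (s * I) ^ 3‖ := by congr 1; ring
      _ ≤ K * s ^ 4 + (1 - |s| ^ 2 / 2) + c * |s| ^ 3 := by
          refine norm_add₃_le.trans ?_
          rw [hre, hcube]
          gcongr
          exact h s hs1
      _ ≤ -(s ^ 2 / 4) + 1 := by rw [hs4, hsq]; linarith
      _ ≤ _ := by
          refine (Real.add_one_le_exp _).trans_eq ?_
          ring_nf
  · set w : ℂ := -s ^ 2 / 2 + γ / 6 * (s * I) ^ 3 with hw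
    have hwn : ‖w‖ ≤ |s| ^ 2 := by
      refine (norm_add_le _ _).trans ?_
      rw [hcube]
      have : ‖-(s : ℂ) ^ 2 / 2‖ = |s| ^ 2 / 2 := by simp
      rw [this]
      linarith
    have hexp := Complex.norm_exp_sub_one_sub_id_le (hwn.trans hs2')
    calc ‖charFun μ s - cexp w‖
        = ‖(charFun μ s - (1 - s ^ 2 / 2 + γ / 6 * (s * I) ^ 3)) - (cexp w - 1 - w)‖ := by
          congr 1; rw [hw]; ring
      _ ≤ K * s ^ 4 + ‖w‖ ^ 2 := (norm_sub_le _ _).trans (add_le_add (h s hs1) hexp)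
      _ ≤ K * s ^ 4 + (|s| ^ 2) ^ 2 := by gcongr
      _ = _ := by rw [hs4]; ring

lemma norm_pow_sub_edgeworth_le {z : ℂ} {s c K : ℝ} {n : ℕ} (hn : 1 ≤ n) (hs : |s| ≤ 1)
    (hz : ‖z‖ ≤ Real.exp (-s ^ 2 / 4))
    (hzc : ‖z - cexp (-s ^ 2 / 2 + c * (s * I) ^ 3)‖ ≤ K * s ^ 4) :
    ‖z ^ n - cexp (-n * s ^ 2 / 2) * (1 + n * c * (s * I) ^ 3)‖
      ≤ (2 * n * K * s ^ 4 + 3 * (n * c * s ^ 3) ^ 2) * Real.exp (-n * s ^ 2 / 4) := by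
  set b := cexp (-s ^ 2 / 2 + c * (s * I) ^ 3)
  have hI3 : ((s : ℂ) * I) ^ 3 = -(s ^ 3 : ℝ) * I := by
    rw [mul_pow, I_pow_three]; push_cast; ring
  have hbn : ‖b‖ ≤ Real.exp (-s ^ 2 / 4) := by
    rw [Complex.norm_exp, hI3]
    refine Real.exp_le_exp.2 ?_
    have : (-(s : ℂ) ^ 2 / 2 + c * (-(s ^ 3 : ℝ) * I)).re = -s ^ 2 / 2 := by
      rw [show -(s : ℂ) ^ 2 / 2 + c * (-(s ^ 3 : ℝ) * I)
        = ((-s ^ 2 / 2 : ℝ) : ℂ) + ((-c * s ^ 3 : ℝ) : ℂ) * I by push_cast; ring]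
      rw [add_re, ofReal_re, re_ofReal_mul, I_re, mul_zero, add_zero]
    rw [this]
    nlinarith [sq_nonneg s]
  have hexp : Real.exp (-s ^ 2 / 4) ^ (n - 1) ≤ 2 * Real.exp (-n * s ^ 2 / 4) := by
    rw [← Real.exp_nat_mul, Nat.cast_sub hn, Nat.cast_one,
      show ((n : ℝ) - 1) * (-s ^ 2 / 4) = s ^ 2 / 4 + -n * s ^ 2 / 4 by ring, Real.exp_add]
    gcongr
    have h1 : s ^ 2 ≤ 1 := (sq_le_one_iff_abs_le_one s).2 hs
    calc Real.exp (s ^ 2 / 4) ≤ Real.exp (1 / 4) := by gcongr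
      _ ≤ 1 / (1 - 1 / 4) := Real.exp_bound_div_one_sub_of_interval (by norm_num) (by norm_num)
      _ ≤ 2 := by norm_num
  have h1 : ‖z ^ n - b ^ n‖ ≤ 2 * n * K * s ^ 4 * Real.exp (-n * s ^ 2 / 4) := by
    calc _ ≤ n * ‖z - b‖ * Real.exp (-s ^ 2 / 4) ^ (n - 1) := norm_pow_sub_pow_le hz hbn n
      _ ≤ n * (K * s ^ 4) * (2 * Real.exp (-n * s ^ 2 / 4)) := by
          have : 0 ≤ K * s ^ 4 := (norm_nonneg _).trans hzc
          gcongr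
      _ = _ := by ring
  set u : ℝ := -(n * c * s ^ 3)
  have hbpow : b ^ n = cexp (-n * s ^ 2 / 2) * cexp (u * I) := by
    rw [← Complex.exp_nat_mul, ← Complex.exp_add, hI3]
    congr 1
    push_cast [u]
    ring
  have hexpn : ‖cexp (-n * s ^ 2 / 2)‖ ≤ Real.exp (-n * s ^ 2 / 4) := by
    rw [show (-n * s ^ 2 / 2 : ℂ) = ((-n * s ^ 2 / 2 : ℝ) : ℂ) by push_cast; rfl,
      Complex.norm_exp_ofReal]
    refine Real.exp_le_exp.2 ?_
    have : 0 ≤ n * s ^ 2 := by positivity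
    linarith
  have h2 : ‖b ^ n - cexp (-n * s ^ 2 / 2) * (1 + n * c * (s * I) ^ 3)‖
      ≤ 3 * (n * c * s ^ 3) ^ 2 * Real.exp (-n * s ^ 2 / 4) := by
    rw [hbpow, hI3, show cexp (-n * s ^ 2 / 2) * cexp (u * I)
        - cexp (-n * s ^ 2 / 2) * (1 + n * c * (-(s ^ 3 : ℝ) * I))
      = (cexp (u * I) - 1 - u * I) * cexp (-n * s ^ 2 / 2) by push_cast [u]; ring, norm_mul]
    gcongr
    refine (norm_cexp_mul_I_sub_one_sub_le u).trans_eq ?_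
    simp only [u]; ring
  calc _ = ‖(z ^ n - b ^ n) + (b ^ n - cexp (-n * s ^ 2 / 2) * (1 + n * c * (s * I) ^ 3))‖ := by
        congr 1; ring
    _ ≤ _ := (norm_add_le _ _).trans (add_le_add h1 h2)
    _ = _ := by ring

/-- Edgeworth expansion of the characteristic function of a normalized sum. -/
lemma exists_norm_charFun_pow_sub_le (hmean : ∫ x, x ∂μ = 0) (hvar : ∫ x, x ^ 2 ∂μ = 1)
    (hfourth : Integrable (fun x => x ^ 4) μ)
    (hcramer : ∀ δ > 0, ∃ ρ < 1, 0 ≤ ρ ∧ ∀ s, δ ≤ |s| → ‖charFun μ s‖ ≤ ρ) :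
    ∃ A B ρ : ℝ, 0 ≤ A ∧ 0 ≤ B ∧ 0 ≤ ρ ∧ ρ < 1 ∧ ∀ n : ℕ, 1 ≤ n → ∀ t : ℝ,
      ‖charFun μ (t / √n) ^ n
        - cexp (-t ^ 2 / 2) * (1 + (∫ x, x ^ 3 ∂μ : ℝ) / (6 * √n) * (t * I) ^ 3)‖
      ≤ |t| * (A / n * ((1 + t ^ 6) * Real.exp (-t ^ 2 / 4)) + B * ρ ^ n) := by
  obtain ⟨δ, hδ, hδ1, K, hK, hloc⟩ := exists_norm_charFun_sub_cexp_le hmean hvar hfourth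
  obtain ⟨ρ, hρ1, hρ0, hρ⟩ := hcramer δ hδ
  set γ := ∫ x, x ^ 3 ∂μ
  set c := γ / 6 with hc
  refine ⟨2 * K + 3 * c ^ 2 + δ⁻¹ ^ 2 * (1 + |c|), δ⁻¹, ρ, by positivity, by positivity, hρ0, hρ1,
    fun n hn t => ?_⟩
  have hn0 : (0 : ℝ) < n := by exact_mod_cast hn
  have hn1 : (1 : ℝ) ≤ n := by exact_mod_cast hn
  have hr : 0 < √(n : ℝ) := by positivity
  have hr2 : √(n : ℝ) ^ 2 = n := Real.sq_sqrt hn0.le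
  have hr1 : 1 ≤ √(n : ℝ) := Real.one_le_sqrt.2 hn1
  set s := t / √(n : ℝ) with hs
  have ht : t = √(n : ℝ) * s := by rw [hs]; field_simp
  have ht2 : t ^ 2 = n * s ^ 2 := by rw [ht, mul_pow, hr2]
  have ht6 : t ^ 6 = |t| ^ 6 := ((by decide : Even 6).pow_abs t).symm
  have ht0 := abs_nonneg t
  have hE : 0 ≤ Real.exp (-t ^ 2 / 4) := (Real.exp_pos _).le
  have hpow : ∀ k ≤ 6, |t| ^ k ≤ 1 + t ^ 6 := fun k hk => by
    rw [ht6]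
    by_cases h1 : |t| ≤ 1
    · have := pow_le_one₀ (n := k) ht0 h1
      have : 0 ≤ |t| ^ 6 := by positivity
      linarith
    · have := pow_le_pow_right₀ (not_le.1 h1).le hk
      linarith
  by_cases hsδ : |s| ≤ δ
  · obtain ⟨h1, h2⟩ := hloc s hsδ
    have h3 := norm_pow_sub_edgeworth_le (c := c) hn (hsδ.trans hδ1) h1
      (by simpa only [hc, ofReal_div, ofReal_ofNat] using h2)
    have e1 : cexp (-n * s ^ 2 / 2) = cexp (-t ^ 2 / 2) := by
      congr 1
      have : (t : ℂ) ^ 2 = n * s ^ 2 := by exact_mod_cast ht2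
      rw [this]; ring
    have e2 : (n * c * (s * I) ^ 3 : ℂ) = γ / (6 * √n) * (t * I) ^ 3 := by
      have hrc : (√(n : ℝ) : ℂ) ^ 2 = n := by exact_mod_cast hr2
      have hrc0 : (√(n : ℝ) : ℂ) ≠ 0 := by exact_mod_cast hr.ne'
      rw [ht, hc, ← hrc]
      push_cast
      field_simp
    have e3 : Real.exp (-n * s ^ 2 / 4) = Real.exp (-t ^ 2 / 4) := by
      rw [ht2]; ring_nf
    rw [e1, e2, e3] at h3
    refine h3.trans ?_
    have e4 : n * s ^ 4 = |t| * (|t| ^ 3 / n) := by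
      have : t ^ 4 = |t| ^ 4 := ((by decide : Even 4).pow_abs t).symm
      rw [show |t| * (|t| ^ 3 / n) = |t| ^ 4 / n by ring, ← this,
        show t ^ 4 = (t ^ 2) ^ 2 by ring, ht2]
      field_simp
    have e5 : (n * c * s ^ 3) ^ 2 = |t| * (c ^ 2 * (|t| ^ 5 / n)) := by
      rw [show |t| * (c ^ 2 * (|t| ^ 5 / n)) = c ^ 2 * (|t| ^ 6 / n) by ring, ← ht6,
        show t ^ 6 = (t ^ 2) ^ 3 by ring, ht2]
      field_simp
    calc _ = |t| * (((2 * K) * |t| ^ 3 + (3 * c ^ 2) * |t| ^ 5) / n * Real.exp (-t ^ 2 / 4)) := by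
          rw [show 2 * n * K * s ^ 4 = 2 * K * (n * s ^ 4) by ring, e4, e5]; ring
      _ ≤ |t| * (((2 * K) * (1 + t ^ 6) + (3 * c ^ 2) * (1 + t ^ 6)) / n
            * Real.exp (-t ^ 2 / 4)) := by
          gcongr
          · exact hpow 3 (by norm_num)
          · exact hpow 5 (by norm_num)
      _ = |t| * ((2 * K + 3 * c ^ 2) / n * ((1 + t ^ 6) * Real.exp (-t ^ 2 / 4))) := by ring
      _ ≤ _ := by
          have : 0 ≤ δ⁻¹ ^ 2 * (1 + |c|) := by positivity
          have : 0 ≤ δ⁻¹ * ρ ^ n := by positivity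
          have : 0 ≤ (1 + t ^ 6) * Real.exp (-t ^ 2 / 4) := by positivity
          refine mul_le_mul_of_nonneg_left ?_ ht0
          refine (le_add_of_nonneg_right ‹0 ≤ δ⁻¹ * ρ ^ n›).trans' ?_
          gcongr ?_ / _ * _
          linarith
  · push Not at hsδ
    have hst : |t| = √n * |s| := by rw [ht, abs_mul, abs_of_pos hr]
    have hbig : 1 ≤ |t| * δ⁻¹ := by
      rw [← div_eq_mul_inv, le_div_iff₀ hδ, hst]
      nlinarith [abs_nonneg s]
    have hbig2 : 1 ≤ |t| ^ 2 * (δ⁻¹ ^ 2 / n) := by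
      rw [show |t| ^ 2 * (δ⁻¹ ^ 2 / n) = (|t| / √n * δ⁻¹) ^ 2 by
        rw [mul_pow, div_pow, hr2]; ring, hst]
      refine one_le_pow₀ ?_
      rw [mul_div_cancel_left₀ _ hr.ne', ← div_eq_mul_inv, le_div_iff₀ hδ]
      linarith
    have h1 : ‖charFun μ s ^ n‖ ≤ |t| * (δ⁻¹ * ρ ^ n) := by
      rw [norm_pow]
      calc _ ≤ ρ ^ n := by gcongr; exact hρ s hsδ.le
        _ = 1 * ρ ^ n := (one_mul _).symm
        _ ≤ |t| * δ⁻¹ * ρ ^ n := by gcongr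
        _ = _ := by ring
    have h2 : ‖cexp (-t ^ 2 / 2) * (1 + γ / (6 * √n) * (t * I) ^ 3)‖
        ≤ |t| * (δ⁻¹ ^ 2 * (1 + |c|) / n * ((1 + t ^ 6) * Real.exp (-t ^ 2 / 4))) := by
      have e1 : ‖cexp (-t ^ 2 / 2)‖ ≤ Real.exp (-t ^ 2 / 4) := by
        rw [show (-t ^ 2 / 2 : ℂ) = ((-t ^ 2 / 2 : ℝ) : ℂ) by push_cast; rfl,
          Complex.norm_exp_ofReal]
        refine Real.exp_le_exp.2 ?_
        nlinarith [sq_nonneg t]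
      have e2 : ‖(1 : ℂ) + γ / (6 * √n) * (t * I) ^ 3‖ ≤ 1 + |c| * |t| ^ 3 := by
        refine (norm_add_le _ _).trans ?_
        have : ‖(γ : ℂ) / (6 * √n) * (t * I) ^ 3‖ = |c| * |t| ^ 3 / √n := by
          simp [hc, abs_div, abs_of_pos hr]
          field_simp
        rw [this, norm_one]
        gcongr
        exact div_le_self (by positivity) hr1
      rw [norm_mul]
      calc _ ≤ Real.exp (-t ^ 2 / 4) * (1 + |c| * |t| ^ 3) := by gcongr
        _ ≤ (|t| ^ 2 * (δ⁻¹ ^ 2 / n)) * (Real.exp (-t ^ 2 / 4) * (1 + |c| * |t| ^ 3)) :=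
            le_mul_of_one_le_left (by positivity) hbig2
        _ = |t| * (δ⁻¹ ^ 2 * (|t| ^ 1 + |c| * |t| ^ 4) / n * Real.exp (-t ^ 2 / 4)) := by ring
        _ ≤ |t| * (δ⁻¹ ^ 2 * ((1 + t ^ 6) + |c| * (1 + t ^ 6)) / n * Real.exp (-t ^ 2 / 4)) := by
            gcongr
            · exact hpow 1 (by norm_num)
            · exact hpow 4 (by norm_num)
        _ = _ := by ring
    refine (norm_sub_le _ _).trans ((add_le_add h1 h2).trans ?_)
    rw [← mul_add, add_comm]
    gcongr
    have : 0 ≤ 2 * K + 3 * c ^ 2 := by positivity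
    linarith

end Expansion

section GaussianHermite

lemma charFun_gaussianReal_zero_one :
    charFun (gaussianReal 0 1) = fun t : ℝ => cexp (-t ^ 2 / 2) := by
  ext t
  rw [charFun_gaussianReal]
  congr 1
  push_cast
  ring

lemma hasDerivAt_cexp_neg_sq_div_two (t : ℝ) :
    HasDerivAt (fun t : ℝ => cexp (-t ^ 2 / 2)) (-t * cexp (-t ^ 2 / 2)) t := by
  have h : HasDerivAt (fun t : ℝ => (-(t : ℂ) ^ 2 / 2)) (-(t : ℂ)) t := by
    have := (((hasDerivAt_id t).ofReal_comp.pow 2).neg.div_const 2)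
    refine this.congr_deriv ?_
    simp
    ring
  exact h.cexp.congr_deriv (mul_comm _ _)

lemma integrable_pow_gaussianReal (k : ℕ) (v : ℝ≥0) :
    Integrable (fun w => w ^ k) (gaussianReal 0 v) := by
  have := (memLp_id_gaussianReal (μ := 0) (v := v) k).integrable_norm_pow'
  refine (integrable_norm_iff (by fun_prop)).1 ?_
  simpa using this

lemma iteratedDeriv_charFun_gaussianReal (k : ℕ) (t : ℝ) :
    iteratedDeriv k (fun t : ℝ => cexp (-t ^ 2 / 2)) t
      = I ^ k * ∫ w, (w : ℂ) ^ k * cexp (t * w * I) ∂gaussianReal 0 1 := by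
  rw [← charFun_gaussianReal_zero_one]
  exact iteratedDeriv_charFun (by exact_mod_cast memLp_id_gaussianReal (k : ℝ≥0))

/-- The Fourier transform of the Gaussian measure with density `1 + c H₃`, where `H₃` is the third
Hermite polynomial. -/
lemma integral_hermite_mul_cexp_gaussianReal (c t : ℝ) :
    ∫ w, ((1 + c * (w ^ 3 - 3 * w) : ℝ) : ℂ) * cexp (t * w * I) ∂gaussianReal 0 1
      = cexp (-t ^ 2 / 2) * (1 + c * (t * I) ^ 3) := by
  have d1 : iteratedDeriv 1 (fun t : ℝ => cexp (-t ^ 2 / 2))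
      = fun t : ℝ => -t * cexp (-t ^ 2 / 2) := by
    ext t
    rw [iteratedDeriv_one, (hasDerivAt_cexp_neg_sq_div_two t).deriv]
  have d2 : iteratedDeriv 2 (fun t : ℝ => cexp (-t ^ 2 / 2))
      = fun t : ℝ => (t ^ 2 - 1) * cexp (-t ^ 2 / 2) := by
    ext t
    rw [iteratedDeriv_succ, d1]
    have := (hasDerivAt_id t).ofReal_comp.neg.mul (hasDerivAt_cexp_neg_sq_div_two t)
    refine (this.congr_deriv ?_).deriv
    simp
    ring
  have d3 : iteratedDeriv 3 (fun t : ℝ => cexp (-t ^ 2 / 2))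
      = fun t : ℝ => (3 * t - t ^ 3) * cexp (-t ^ 2 / 2) := by
    ext t
    rw [iteratedDeriv_succ, d2]
    have := (((hasDerivAt_id t).ofReal_comp.pow 2).sub_const 1).mul
      (hasDerivAt_cexp_neg_sq_div_two t)
    refine (this.congr_deriv ?_).deriv
    simp
    ring
  have m0 := iteratedDeriv_charFun_gaussianReal 0 t
  have m1 := iteratedDeriv_charFun_gaussianReal 1 t
  have m3 := iteratedDeriv_charFun_gaussianReal 3 t
  rw [iteratedDeriv_zero] at m0
  rw [d1] at m1
  rw [d3, I_pow_three] at m3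
  simp only [pow_zero, one_mul, pow_one] at m0 m1 m3
  have hint : ∀ k : ℕ, Integrable (fun w : ℝ => (w : ℂ) ^ k * cexp (t * w * I))
      (gaussianReal 0 1) := fun k => by
    refine (integrable_pow_gaussianReal k 1).norm.mono' (by fun_prop) (ae_of_all _ fun w => ?_)
    rw [norm_mul, norm_cexp_mul_mul_I, mul_one]
    simp
  have h0 := hint 0
  have h1 := hint 1
  simp only [pow_zero, one_mul, pow_one] at h0 h1
  have e : ∀ w : ℝ, ((1 + c * (w ^ 3 - 3 * w) : ℝ) : ℂ) * cexp (t * w * I)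
      = cexp (t * w * I) + c * (w ^ 3 * cexp (t * w * I) - 3 * (w * cexp (t * w * I))) := by
    intro w
    push_cast
    ring
  simp_rw [e]
  have h31 : Integrable (fun w : ℝ => (w : ℂ) ^ 3 * cexp (t * w * I) - 3 * (w * cexp (t * w * I)))
      (gaussianReal 0 1) := (hint 3).sub (h1.const_mul 3)
  rw [integral_add h0 (h31.const_mul _), integral_const_mul,
    integral_sub (hint 3) (h1.const_mul 3), integral_const_mul, ← m0]
  have n1 : ∫ w : ℝ, (w : ℂ) * cexp (t * w * I) ∂gaussianReal 0 1
      = I * (t * cexp (-t ^ 2 / 2)) := by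
    linear_combination I * m1 + (∫ w : ℝ, (w : ℂ) * cexp (t * w * I) ∂gaussianReal 0 1) * I_sq
  have n3 : ∫ w : ℝ, (w : ℂ) ^ 3 * cexp (t * w * I) ∂gaussianReal 0 1
      = I * ((3 * t - t ^ 3) * cexp (-t ^ 2 / 2)) := by
    linear_combination (-I) * m3
      + (∫ w : ℝ, (w : ℂ) ^ 3 * cexp (t * w * I) ∂gaussianReal 0 1) * I_sq
  rw [n1, n3, mul_pow, I_pow_three]
  ring

end GaussianHermite

section Law

variable {μ : Measure ℝ}

lemma charFun_map_sum_div_sqrt [IsProbabilityMeasure μ] (n : ℕ) (t : ℝ) :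
    charFun ((Measure.pi fun _ : Fin n => μ).map fun ω => (∑ i, ω i) / √n) t
      = charFun μ (t / √n) ^ n := by
  have h : (fun ω : Fin n → ℝ => (∑ i, ω i) / √(n : ℝ))
      = (fun x : ℝ => (√(n : ℝ))⁻¹ * x) ∘ fun ω => ∑ i, ω i := by
    ext ω
    simp [div_eq_inv_mul]
  rw [h, ← Measure.map_map (by fun_prop) (by fun_prop), charFun_map_mul,
    charFun_map_sum_pi_eq_prod]
  simp [div_eq_inv_mul]

lemma exists_smul_volume_restrict_le {p a b c : ℝ} {ν : Measure ℝ} {d : ℝ → ℝ≥0∞} (hp : 0 < p)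
    (hc : 0 < c) (hν : ν = volume.withDensity d) (hd : ∀ x ∈ Set.Icc a b, ENNReal.ofReal c ≤ d x)
    (hμ : ENNReal.ofReal p • ν ≤ μ) :
    ∃ q : ℝ≥0, 0 < q ∧ (q : ℝ≥0∞) • volume.restrict (Set.Icc a b) ≤ μ := by
  refine ⟨p.toNNReal * c.toNNReal, by positivity, le_trans ?_ hμ⟩
  rw [ENNReal.coe_mul, mul_smul]
  change ENNReal.ofReal p • ENNReal.ofReal c • _ ≤ _
  refine Measure.le_iff.2 fun s hs => ?_
  rw [Measure.smul_apply, Measure.smul_apply]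
  refine mul_le_mul_right ?_ _
  subst hν
  change _ ≤ (volume.withDensity d) s
  rw [withDensity_apply _ hs, Measure.restrict_apply hs, smul_eq_mul,
    ← setLIntegral_const]
  calc _ ≤ ∫⁻ x in s ∩ Set.Icc a b, d x :=
        setLIntegral_mono' (hs.inter measurableSet_Icc) fun x hx => hd x hx.2
    _ ≤ _ := lintegral_mono_set Set.inter_subset_left

end Law

section Bounds

lemma integrable_one_add_pow_six_mul_exp :
    Integrable fun t : ℝ => (1 + t ^ 6) * Real.exp (-t ^ 2 / 4) := by
  have h0 := integrable_exp_neg_mul_sq (b := 1 / 4) (by norm_num)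
  have h6 := integrable_rpow_mul_exp_neg_mul_sq (b := 1 / 4) (by norm_num) (s := (6 : ℕ))
    (by norm_num)
  refine (h0.add h6).congr (ae_of_all _ fun t => ?_)
  simp only [Pi.add_apply, Real.rpow_natCast]
  rw [show -(1 / 4) * t ^ 2 = -t ^ 2 / 4 by ring]
  ring

lemma integral_gaussianReal_le {f : ℝ → ℝ} {v : ℝ≥0} (hv : v ≠ 0) (hf0 : ∀ t, 0 ≤ f t)
    (hf : Integrable f) :
    ∫ t, f t ∂gaussianReal 0 v ≤ (√(2 * Real.pi * v))⁻¹ * ∫ t, f t := by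
  rw [integral_gaussianReal_eq_integral_smul hv, ← integral_const_mul]
  refine integral_mono_of_nonneg
    (ae_of_all _ fun t => mul_nonneg (gaussianPDFReal_nonneg _ _ _) (hf0 t))
    (hf.const_mul _) (ae_of_all _ fun t => ?_)
  refine mul_le_mul_of_nonneg_right ?_ (hf0 t)
  refine mul_le_of_le_one_right (by positivity) (Real.exp_le_one_iff.2 ?_)
  exact div_nonpos_of_nonpos_of_nonneg (neg_nonpos.2 (sq_nonneg _)) (by positivity)

lemma exists_mul_pow_le_div {ρ : ℝ} (h0 : 0 ≤ ρ) (h1 : ρ < 1) :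
    ∃ C, 0 ≤ C ∧ ∀ n : ℕ, 1 ≤ n → n * ρ ^ n ≤ C / n := by
  obtain ⟨C, hC⟩ := (tendsto_pow_const_mul_const_pow_of_lt_one 2 h0 h1).bddAbove_range
  refine ⟨C, ?_, fun n hn => ?_⟩
  · simpa using hC (Set.mem_range_self 0)
  · have hn0 : (0 : ℝ) < n := by exact_mod_cast hn
    have := hC (Set.mem_range_self n)
    rw [le_div_iff₀ hn0]
    linarith

lemma integral_smoothing_bound_le {f : ℝ → ℝ} (hf0 : ∀ t, 0 ≤ f t) (hf : Integrable f) {v : ℝ≥0}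
    (hv : v ≠ 0) (hfv : Integrable f (gaussianReal 0 v⁻¹)) {α β : ℝ} (hα : 0 ≤ α) (hβ : 0 ≤ β) :
    (√(2 * Real.pi * v))⁻¹ * (2 * ∫ t, (α * f t + β) ∂gaussianReal 0 v⁻¹)
      ≤ α * (∫ t, f t) + 2 * β * (√v)⁻¹ := by
  have hI : 0 ≤ ∫ t, f t := integral_nonneg hf0
  have hs : 0 < √(v : ℝ) := by positivity
  have hpi : 1 ≤ √(2 * Real.pi) := Real.one_le_sqrt.2 (by linarith [Real.two_le_pi])
  have hpi2 : √(2 * Real.pi) * √(2 * Real.pi) = 2 * Real.pi :=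
    Real.mul_self_sqrt (by positivity)
  have h1 : ∫ t, (α * f t + β) ∂gaussianReal 0 v⁻¹
      ≤ α * ((√(2 * Real.pi))⁻¹ * √v * ∫ t, f t) + β := by
    rw [integral_add (hfv.const_mul _) (integrable_const _), integral_const_mul]
    have := integral_gaussianReal_le (inv_ne_zero hv) hf0 hf
    rw [Real.sqrt_mul (by positivity), NNReal.coe_inv, Real.sqrt_inv, mul_inv, inv_inv] at this
    simp only [integral_const, probReal_univ, one_smul]
    gcongr
  rw [Real.sqrt_mul (by positivity), mul_inv]
  calc _ ≤ (√(2 * Real.pi))⁻¹ * (√v)⁻¹ *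
        (2 * (α * ((√(2 * Real.pi))⁻¹ * √v * ∫ t, f t) + β)) := by gcongr
    _ = α * (∫ t, f t) * (2 * (√(2 * Real.pi) * √(2 * Real.pi))⁻¹)
        + (√(2 * Real.pi))⁻¹ * (2 * β * (√v)⁻¹) := by
      field_simp
    _ ≤ α * (∫ t, f t) * 1 + 1 * (2 * β * (√v)⁻¹) := by
      gcongr
      · rw [hpi2, ← div_eq_mul_inv, div_le_one (by positivity)]
        linarith [Real.two_le_pi]
      · exact inv_le_one_of_one_le₀ hpi
    _ = _ := by ring

lemma abs_gaussianPDFReal_mul_hermite_le (c w : ℝ) :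
    ‖gaussianPDFReal 0 1 w • (1 + c * (w ^ 3 - 3 * w))‖ ≤ 1 + 36 * |c| := by
  have hpi : 1 ≤ √(2 * Real.pi * (1 : ℝ≥0)) :=
    Real.one_le_sqrt.2 (by norm_num; linarith [Real.two_le_pi])
  have h1 : gaussianPDFReal 0 1 w ≤ Real.exp (-(w ^ 2 / 2)) := by
    rw [gaussianPDFReal]
    refine (mul_le_of_le_one_left (Real.exp_pos _).le (inv_le_one_of_one_le₀ hpi)).trans_eq ?_
    simp
    ring
  have h4 : w ^ 4 ≤ 8 * Real.exp (w ^ 2 / 2) := by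
    have := Real.pow_div_factorial_le_exp (w ^ 2 / 2) (by positivity) 2
    norm_num [Nat.factorial] at this
    nlinarith
  have h0 : 1 ≤ Real.exp (w ^ 2 / 2) := Real.one_le_exp (by positivity)
  have hw : |w ^ 3 - 3 * w| ≤ 4 * (1 + w ^ 4) := by
    rw [abs_le]
    constructor
    · nlinarith [sq_nonneg (w ^ 2 - 1), sq_nonneg (w ^ 2 + w), sq_nonneg (w ^ 2 - w),
        sq_nonneg (w - 1), sq_nonneg (w + 1)]
    · nlinarith [sq_nonneg (w ^ 2 - 1), sq_nonneg (w ^ 2 + w), sq_nonneg (w ^ 2 - w),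
        sq_nonneg (w - 1), sq_nonneg (w + 1)]
  have hc := abs_nonneg c
  rw [norm_smul, Real.norm_of_nonneg (gaussianPDFReal_nonneg _ _ _), Real.norm_eq_abs]
  calc _ ≤ Real.exp (-(w ^ 2 / 2)) * (1 + |c| * (36 * Real.exp (w ^ 2 / 2))) := by
        gcongr
        refine (abs_add_le _ _).trans ?_
        rw [abs_one, abs_mul]
        gcongr
        linarith
    _ = Real.exp (-(w ^ 2 / 2)) + 36 * |c| := by
        rw [mul_add, mul_one, Real.exp_neg]
        field_simp
    _ ≤ _ := by
        gcongr
        exact Real.exp_le_one_iff.2 (neg_nonpos.2 (by positivity))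

lemma integrable_hermite_gaussianReal (c : ℝ) :
    Integrable (fun w => 1 + c * (w ^ 3 - 3 * w)) (gaussianReal 0 1) := by
  have h1 := integrable_pow_gaussianReal 1 1
  simp only [pow_one] at h1
  exact (integrable_const 1).add
    (((integrable_pow_gaussianReal 3 1).sub (h1.const_mul 3)).const_mul c)

lemma setIntegral_Iic_gaussianReal (f : ℝ → ℝ) (x : ℝ) :
    ∫ w in Set.Iic x, f w ∂gaussianReal 0 1 = ∫ w in Set.Iic x, gaussianPDFReal 0 1 w • f w := by
  rw [← integral_indicator measurableSet_Iic, ← integral_indicator measurableSet_Iic,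
    integral_gaussianReal_eq_integral_smul one_ne_zero]
  congr with w
  by_cases hw : w ∈ Set.Iic x <;> simp [hw]

lemma integrable_gaussianPDFReal_smul {f : ℝ → ℝ} (hf : Integrable f (gaussianReal 0 1)) :
    Integrable fun w => gaussianPDFReal 0 1 w • f w := by
  rw [gaussianReal_of_var_ne_zero _ one_ne_zero] at hf
  simpa using (integrable_withDensity_iff_integrable_smul' (measurable_gaussianPDF 0 1)
    (ae_of_all _ fun _ => gaussianPDF_lt_top)).1 hf

lemma abs_setIntegral_hermite_sub_le (c x y : ℝ) :
    |∫ w in Set.Iic x, (1 + c * (w ^ 3 - 3 * w)) ∂gaussianReal 0 1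
      - ∫ w in Set.Iic y, (1 + c * (w ^ 3 - 3 * w)) ∂gaussianReal 0 1|
      ≤ (1 + 36 * |c|) * |x - y| := by
  have h := integrable_gaussianPDFReal_smul (integrable_hermite_gaussianReal c)
  rw [setIntegral_Iic_gaussianReal, setIntegral_Iic_gaussianReal,
    intervalIntegral.integral_Iic_sub_Iic h.integrableOn h.integrableOn, ← Real.norm_eq_abs]
  exact intervalIntegral.norm_integral_le_of_norm_le_const
    fun w _ => abs_gaussianPDFReal_mul_hermite_le c w

lemma setIntegral_hermite_eq (c x : ℝ) :
    ∫ w in Set.Iic x, (1 + c * (w ^ 3 - 3 * w)) ∂gaussianReal 0 1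
      = (∫ y in Set.Iic x, Real.exp (-y ^ 2 / 2)) / √(2 * Real.pi)
        + c / √(2 * Real.pi) * ∫ y in Set.Iic x, (y ^ 3 - 3 * y) * Real.exp (-y ^ 2 / 2) := by
  have hpdf : ∀ y : ℝ, gaussianPDFReal 0 1 y = (√(2 * Real.pi))⁻¹ * Real.exp (-y ^ 2 / 2) := by
    intro y
    simp [gaussianPDFReal]
  have hs : √(2 * Real.pi) ≠ 0 := by positivity
  have h0 := integrable_gaussianPDFReal_smul (integrable_const (1 : ℝ))
  have h1 := integrable_gaussianPDFReal_smul (f := fun y => c * (y ^ 3 - 3 * y))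
    (((integrable_hermite_gaussianReal c).sub (integrable_const 1)).congr
      (ae_of_all _ fun y => by simp))
  rw [setIntegral_Iic_gaussianReal]
  simp_rw [smul_add]
  rw [integral_add h0.integrableOn h1.integrableOn]
  congr 1
  · simp_rw [hpdf, smul_eq_mul, mul_one]
    rw [integral_const_mul, div_eq_inv_mul]
  · rw [← integral_const_mul]
    congr with y
    rw [hpdf, smul_eq_mul]
    ring

end Bounds

section Main

lemma integrable_setIntegral_Iic_sub {m : Measure ℝ} [IsFiniteMeasure m] {h : ℝ → ℝ}
    (hh : Integrable h m) (N : Measure ℝ) [IsFiniteMeasure N] (x : ℝ) :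
    Integrable (fun z => ∫ w in Set.Iic (x - z), h w ∂m) N := by
  refine (integrable_const (∫ w, ‖h w‖ ∂m)).mono' ?_
    (ae_of_all _ fun z => norm_setIntegral_Iic_le hh (x - z))
  exact ((measurable_setIntegral_Iic hh).comp_measurable
    (measurable_const.sub measurable_id)).aestronglyMeasurable

variable {μ : Measure ℝ} [IsProbabilityMeasure μ]

lemma exists_abs_cdf_sub_le (hmean : ∫ x, x ∂μ = 0) (hvar : ∫ x, x ^ 2 ∂μ = 1)
    (hfourth : Integrable (fun x => x ^ 4) μ)
    (hcramer : ∀ δ > 0, ∃ ρ < 1, 0 ≤ ρ ∧ ∀ s, δ ≤ |s| → ‖charFun μ s‖ ≤ ρ) :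
    ∃ C : ℝ, ∀ n : ℕ, 1 ≤ n → ∀ x : ℝ,
      |((Measure.pi fun _ : Fin n => μ).map fun ω => (∑ i, ω i) / √n).real (Set.Iic x)
        - ∫ w in Set.Iic x, (1 + (∫ x, x ^ 3 ∂μ) / (6 * √n) * (w ^ 3 - 3 * w)) ∂gaussianReal 0 1|
      ≤ C / n := by
  obtain ⟨A, B, ρ, hA, hB, hρ0, hρ1, hF⟩ :=
    exists_norm_charFun_pow_sub_le hmean hvar hfourth hcramer
  obtain ⟨R, hR0, hR⟩ := exists_mul_pow_le_div hρ0 hρ1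
  set γ := ∫ x, x ^ 3 ∂μ
  set f : ℝ → ℝ := fun t => (1 + t ^ 6) * Real.exp (-t ^ 2 / 4)
  have hf0 : ∀ t, 0 ≤ f t := fun t => by positivity
  refine ⟨3 * 2 * (1 + 36 * |γ|) + 2 * (A * (∫ t, f t) + 2 * B * R), fun n hn x => ?_⟩
  have hn0 : (0 : ℝ) < n := by exact_mod_cast hn
  have hn1 : (1 : ℝ) ≤ n := by exact_mod_cast hn
  set m := (Measure.pi fun _ : Fin n => μ).map fun ω => (∑ i, ω i) / √(n : ℝ)
  have : IsProbabilityMeasure m := Measure.isProbabilityMeasure_map (by fun_prop)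
  set c := γ / (6 * √(n : ℝ))
  have hc : |c| ≤ |γ| := by
    rw [abs_div]
    refine div_le_self (abs_nonneg _) ?_
    rw [abs_of_pos (by positivity)]
    linarith [Real.one_le_sqrt.2 hn1]
  set h : ℝ → ℝ := fun w => 1 + c * (w ^ 3 - 3 * w)
  have hh : Integrable h (gaussianReal 0 1) := integrable_hermite_gaussianReal c
  set v : ℝ≥0 := ((n : ℝ≥0)⁻¹) ^ 2 with hv
  have hv0 : v ≠ 0 := by
    have : (n : ℝ≥0) ≠ 0 := by exact_mod_cast hn0.ne'
    positivity
  have hsv : √(v : ℝ) = (n : ℝ)⁻¹ := by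
    rw [hv]
    push_cast
    exact Real.sqrt_sq (by positivity)
  have hfv : Integrable f (gaussianReal 0 v⁻¹) := by
    refine ((integrable_const (1 : ℝ)).add (integrable_pow_gaussianReal 6 v⁻¹)).mono'
      (by fun_prop) (ae_of_all _ fun t => ?_)
    rw [Real.norm_of_nonneg (hf0 t)]
    refine mul_le_of_le_one_right (by positivity) (Real.exp_le_one_iff.2 ?_)
    linarith [sq_nonneg t]
  have hone : Integrable (fun _ : ℝ => (1 : ℝ)) m := integrable_const 1
  have hsmooth : ∀ y, |smoothedCDF m (fun _ => 1) v y - smoothedCDF (gaussianReal 0 1) h v y|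
      ≤ (A * (∫ t, f t) + 2 * B * R) / n := by
    intro y
    refine (abs_smoothedCDF_sub_le hv0 hone hh (B := fun t => A / n * f t + B * ρ ^ n)
      ((hfv.const_mul _).add (integrable_const _)) (fun t _ => ?_) y).trans ?_
    · have h1 : ∫ w, ((1 : ℝ) : ℂ) * cexp (t * w * I) ∂m = charFun μ (t / √n) ^ n := by
        rw [← charFun_map_sum_div_sqrt, charFun_apply_real]
        simp [m]
      have h2 := integral_hermite_mul_cexp_gaussianReal c t
      rw [h1, h2]
      have := hF n hn t
      simpa [c] using this
    · refine (integral_smoothing_bound_le hf0 integrable_one_add_pow_six_mul_exp hv0 hfv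
        (by positivity) (by positivity)).trans ?_
      rw [hsv, inv_inv]
      have := mul_le_mul_of_nonneg_left (hR n hn) hB
      calc _ = A * (∫ t, f t) / n + 2 * (B * (n * ρ ^ n)) := by ring
        _ ≤ A * (∫ t, f t) / n + 2 * (B * (R / n)) := by gcongr
        _ = _ := by ring
  have hFint : ∀ y, ∫ _ in Set.Iic y, (1 : ℝ) ∂m = m.real (Set.Iic y) := fun y => by simp
  have key := abs_sub_le_of_abs_integral_le (N := gaussianReal 0 v) (r := 2 * √(v : ℝ))
    (F := fun y => m.real (Set.Iic y)) (G := fun y => ∫ w in Set.Iic y, h w ∂gaussianReal 0 1)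
    (L := 1 + 36 * |γ|) (M₀ := 1 + ∫ w, ‖h w‖ ∂gaussianReal 0 1)
    (η := (A * (∫ t, f t) + 2 * B * R) / n) (by positivity)
    (three_fourths_le_gaussianReal_Icc v hv0)
    (fun a b hab => measureReal_mono (Set.Iic_subset_Iic.2 hab))
    (fun a b => (abs_setIntegral_hermite_sub_le c a b).trans (by gcongr))
    (fun a => by
      rw [← Real.norm_eq_abs]
      refine (norm_sub_le _ _).trans (add_le_add ?_ (norm_setIntegral_Iic_le hh a))
      rw [Real.norm_of_nonneg measureReal_nonneg]
      exact measureReal_le_one)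
    (fun a => by
      refine le_trans (le_of_eq ?_) (hsmooth a)
      rw [integral_sub, smoothedCDF, smoothedCDF]
      · simp_rw [hFint]
      · simpa only [hFint] using integrable_setIntegral_Iic_sub hone (gaussianReal 0 v) a
      · exact integrable_setIntegral_Iic_sub hh (gaussianReal 0 v) a)
    x
  refine key.trans (le_of_eq ?_)
  rw [hsv]
  ring

end Main

end EdgeworthExpansion

/-- **Continuous two-term Edgeworth expansion for distribution functions.**
If the law `μ` of the i.i.d. summands has mean `0`, variance `1`, third moment `γ`, finite
fourth moment, and has a compactly supported continuous component whose density is bounded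
away from `0`, then, uniformly in `x`,
`P(W ≤ x) = Φ(x) + γ/(6√(2πn)) ∫_{-∞}^x (y³-3y) e^{-y²/2} dy + O(1/n)`. -/
theorem continuous_two_term_edgeworth_cdf
    (μ : Measure ℝ) (hprob : IsProbabilityMeasure μ) (γ : ℝ)
    (hmean : ∫ x, x ∂μ = 0)
    (hvar : ∫ x, x ^ 2 ∂μ = 1)
    (hthird : ∫ x, x ^ 3 ∂μ = γ)
    (hfourth : Integrable (fun x => x ^ 4) μ)
    (hcomp : ∃ (p a b c : ℝ) (ν : Measure ℝ) (d : ℝ → ℝ≥0∞),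
      0 < p ∧ p ≤ 1 ∧ a < b ∧ 0 < c ∧
      IsProbabilityMeasure ν ∧
      ν = volume.withDensity d ∧
      (∀ x ∈ Set.Icc a b, ENNReal.ofReal c ≤ d x) ∧
      (∀ x ∉ Set.Icc a b, d x = 0) ∧
      ENNReal.ofReal p • ν ≤ μ) :
    ∃ C : ℝ, ∀ n : ℕ, 1 ≤ n → ∀ x : ℝ,
      |((Measure.pi fun _ : Fin n => μ) {ω | (∑ i, ω i) / Real.sqrt n ≤ x}).toReal -
          (∫ y in Set.Iic x, Real.exp (-y ^ 2 / 2)) / Real.sqrt (2 * Real.pi) -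
          γ / (6 * Real.sqrt (2 * Real.pi * n)) *
            ∫ y in Set.Iic x, (y ^ 3 - 3 * y) * Real.exp (-y ^ 2 / 2)|
        ≤ C / n := by
  obtain ⟨p, a, b, c, ν, d, hp, -, hab, hc, -, hν, hd, -, hνμ⟩ := hcomp
  obtain ⟨q, hq0, hq⟩ := EdgeworthExpansion.exists_smul_volume_restrict_le hp hc hν hd hνμ
  obtain ⟨C, hC⟩ := EdgeworthExpansion.exists_abs_cdf_sub_le hmean hvar hfourth
    fun δ hδ => EdgeworthExpansion.exists_norm_charFun_le hq0 hab hq hδ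
  refine ⟨C, fun n hn x => ?_⟩
  have h := hC n hn x
  rw [EdgeworthExpansion.setIntegral_hermite_eq, hthird, map_measureReal_apply (by fun_prop)
    measurableSet_Iic, ← sub_sub] at h
  have e : γ / (6 * √(n : ℝ)) / √(2 * Real.pi) = γ / (6 * √(2 * Real.pi * n)) := by
    rw [Real.sqrt_mul (by positivity : 0 ≤ 2 * Real.pi) n, div_div]
    ring
  rwa [e] at h
end
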